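/- arXiv:1302.1298 — 2 statements merged into one kernel-verified Lean document; each statement's English description precedes it below -/
import Mathlib

section
/- Let k ≥ 2 and let 0 = i_0 < i_1 < ⋯ < i_k be integers with gcd(i_1,…,i_k) = 1. For d ∈ ℕ let HF(d) = dim_ℂ((R/I_I^A)_d), the dimension of the degree-d homogeneous component of the graded quotient ring R/I_I^A. Then the following identity of formal power series in ℤ⟦t⟧ holds: (1−t)^k · Σ_{d≥0} HF(d)·t^d = 1 − Σ_{j=1}^{k} t^{N − i_j − k(k−1)/2} + Σ_{j=1}^{k−1} t^{N − j − k(k−1)/2}, where N = i_1 + ⋯ + i_k. -/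
open MvPolynomial

/-- The complete homogeneous symmetric polynomial of degree `d ∈ ℤ` in the variables
`x₁, …, x_k`, with the convention `h_d = 0` for `d < 0` (and `h_0 = 1`). -/
noncomputable def completeHomog (k : ℕ) (d : ℤ) : MvPolynomial (Fin k) ℂ :=
  if 0 ≤ d then
    ∑ μ ∈ Finset.Nat.antidiagonalTuple k d.toNat, ∏ b : Fin k, (X b : MvPolynomial (Fin k) ℂ) ^ μ b
  else 0

/-- The `(k+1) × k` matrix `H` over `R = ℂ[x₁,…,x_k]` with `(a,b)`-entry `h_{i_a - (k - b)}`
(rows `a = 0,…,k`, columns `b = 1,…,k`). -/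
noncomputable def Hmat (k : ℕ) (i : Fin (k + 1) → ℕ) :
    Matrix (Fin (k + 1)) (Fin k) (MvPolynomial (Fin k) ℂ) :=
  Matrix.of fun a b => completeHomog k ((i a : ℤ) - ((k : ℤ) - 1 - (b : ℕ)))

/-- `S_l`, the determinant of the `k × k` matrix obtained from `H` by deleting the row
indexed by `l`; up to sign it is the Schur polynomial of the exponent sequence obtained
from `(i₀,…,i_k)` by deleting `i_l`. -/
noncomputable def Spoly (k : ℕ) (i : Fin (k + 1) → ℕ) (l : Fin (k + 1)) :
    MvPolynomial (Fin k) ℂ :=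
  Matrix.det (Matrix.of fun a b : Fin k => Hmat k i (l.succAbove a) b)

/-- The Vandermonde ideal `I_I^A ⊆ R`, generated by `S₀, S₁, …, S_k`. -/
noncomputable def vandermondeIdealA (k : ℕ) (i : Fin (k + 1) → ℕ) :
    Ideal (MvPolynomial (Fin k) ℂ) :=
  Ideal.span (Set.range (Spoly k i))

theorem Polynomial.signVariations_lt_card_support {P : Polynomial ℝ} (hP : P ≠ 0) :
    P.signVariations < P.support.card := by
  induction hn : P.support.card using Nat.strong_induction_on generalizing P with
  | _ n ih =>
    subst hn
    have h1 := Polynomial.signVariations_le_eraseLead_succ (P := P)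
    have h2 := Polynomial.eraseLead_support_card_lt hP
    by_cases h0 : P.eraseLead = 0
    · obtain ⟨d, c, rfl⟩ : ∃ d c, P = Polynomial.monomial d c :=
        ⟨P.natDegree, P.leadingCoeff, by
          conv_lhs => rw [← P.eraseLead_add_monomial_natDegree_leadingCoeff, h0, zero_add]⟩
      rw [Polynomial.signVariations_monomial]
      exact Finset.card_pos.2 (Polynomial.nonempty_support_iff.2 hP)
    · have := ih _ h2 h0 rfl
      omega

/-- Confluent generalised Vandermonde determinants with positive real nodes do not vanish. -/
theorem det_confluent_pow_ne_zero {κ : Type*} [Fintype κ] [DecidableEq κ] {e : κ → ℕ}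
    (he : Function.Injective e) (t : κ → ℝ) (ε : κ → Bool) (ht : ∀ c, 0 < t c)
    (hinj : Function.Injective fun c => (t c, ε c))
    (hε : ∀ c, ε c = true → ∃ c', t c' = t c ∧ ε c' = false) :
    (Matrix.of fun c a => if ε c then (e a : ℝ) * t c ^ (e a - 1) else t c ^ e a).det ≠ 0 := by
  intro hdet
  obtain ⟨L, hL0, hL⟩ := Matrix.exists_mulVec_eq_zero_iff.2 hdet
  set f : Polynomial ℝ := ∑ a, Polynomial.monomial (e a) (L a) with hf
  have hcoeff : ∀ a, f.coeff (e a) = L a := by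
    intro a
    simp [hf, Polynomial.coeff_monomial, he.eq_iff]
  have hf0 : f ≠ 0 := by
    intro h
    apply hL0
    funext a
    rw [← hcoeff a, h]; simp
  have hsupp : f.support.card ≤ Fintype.card κ := by
    have : f.support ⊆ Finset.univ.image e := by
      intro n hn
      by_contra hne
      apply Polynomial.mem_support_iff.1 hn
      simp only [hf, Polynomial.finsetSum_coeff, Polynomial.coeff_monomial]
      refine Finset.sum_eq_zero fun a _ => if_neg ?_
      rintro rfl
      exact hne (Finset.mem_image_of_mem _ (Finset.mem_univ _))
    exact (Finset.card_le_card this).trans Finset.card_image_le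
  have hev : ∀ c, ε c = false → f.IsRoot (t c) := by
    intro c hc
    have := congrFun hL c
    simp only [Matrix.mulVec, dotProduct, Matrix.of_apply, hc, Pi.zero_apply] at this
    simp only [Polynomial.IsRoot, hf, Polynomial.eval_finsetSum, Polynomial.eval_monomial]
    rw [← this]
    exact Finset.sum_congr rfl fun a _ => by simp [mul_comm]
  have hev' : ∀ c, ε c = true → (Polynomial.derivative f).IsRoot (t c) := by
    intro c hc
    have := congrFun hL c
    simp only [Matrix.mulVec, dotProduct, Matrix.of_apply, hc, Pi.zero_apply] at this
    simp only [Polynomial.IsRoot, hf, Polynomial.derivative_sum, Polynomial.derivative_monomial,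
      Polynomial.eval_finsetSum, Polynomial.eval_monomial]
    rw [← this]
    exact Finset.sum_congr rfl fun a _ => by simp; ring
  have hle : Finset.univ.val.map t ≤ f.roots := by
    rw [Multiset.le_iff_count]
    intro s
    rw [Polynomial.count_roots, Multiset.count_map]
    have hcard : (Multiset.filter (fun c => s = t c) Finset.univ.val).card
        = (Finset.univ.filter fun c => s = t c).card := rfl
    rw [hcard]
    by_cases hs : ∃ c, t c = s ∧ ε c = true
    · obtain ⟨c, rfl, hc⟩ := hs
      obtain ⟨c', hc', hcf⟩ := hε c hc
      have h2 : 1 < f.rootMultiplicity (t c) :=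
        (Polynomial.one_lt_rootMultiplicity_iff_isRoot hf0).2 ⟨hc' ▸ hev c' hcf, hev' c hc⟩
      refine le_trans ?_ h2
      calc (Finset.univ.filter fun d => t c = t d).card
          ≤ (Finset.univ : Finset Bool).card := Finset.card_le_card_of_injOn ε
            (fun _ _ => Finset.mem_coe.2 (Finset.mem_univ _)) (by
              intro x hx y hy hxy
              simp only [Finset.coe_filter, Finset.mem_univ, true_and, Set.mem_ofPred_eq] at hx hy
              exact hinj (Prod.ext (hx.symm.trans hy) hxy))
        _ = 2 := by simp
    · push Not at hs
      by_cases hs' : ∃ c, t c = s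
      · obtain ⟨c, rfl⟩ := hs'
        have hroot := hev c (by simpa using hs c rfl)
        have h1 : 0 < f.rootMultiplicity (t c) := (Polynomial.rootMultiplicity_pos hf0).2 hroot
        refine le_trans (Finset.card_le_one.2 ?_) h1
        intro x hx y hy
        simp only [Finset.mem_filter, Finset.mem_univ, true_and] at hx hy
        refine hinj (Prod.ext (hx.symm.trans hy) ?_)
        have a1 := hs x hx.symm
        have a2 := hs y hy.symm
        simp only [Bool.not_eq_true] at a1 a2
        exact a1.trans a2.symm
      · push Not at hs'
        rw [Finset.card_eq_zero.2]
        · exact Nat.zero_le _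
        · exact Finset.filter_eq_empty_iff.2 fun c _ h => hs' c h.symm
  have hcount : Fintype.card κ ≤ f.roots.countP (0 < ·) := by
    refine le_trans (le_of_eq ?_) (Multiset.countP_le_of_le _ hle)
    rw [Multiset.countP_map, Multiset.filter_eq_self.2 fun c _ => ht c]
    rfl
  have h1 := Polynomial.roots_countP_pos_le_signVariations f
  have h2 := Polynomial.signVariations_lt_card_support hf0
  omega

/-- The vector of powers of `x` with exponents `e`. -/
def powRow {κ A : Type*} [CommRing A] (e : κ → ℕ) (x : A) : κ → A := fun a => x ^ e a

/-- The formal derivative of `powRow e x` with respect to `x`. -/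
def derivRow {κ A : Type*} [CommRing A] (e : κ → ℕ) (x : A) : κ → A :=
  fun a => (e a : A) * x ^ (e a - 1)

theorem det_confluent_ne_zero {κ A : Type*} [Fintype κ] [DecidableEq κ] [CommRing A] {e : κ → ℕ}
    (he : Function.Injective e) (φ : A →+* ℂ) (g : κ → A) (t : κ → ℝ) (ε : κ → Bool)
    (hφ : ∀ c, φ (g c) = t c) (ht : ∀ c, 0 < t c)
    (hinj : Function.Injective fun c => (t c, ε c))
    (hε : ∀ c, ε c = true → ∃ c', t c' = t c ∧ ε c' = false) :
    (Matrix.of fun c => if ε c then derivRow e (g c) else powRow e (g c)).det ≠ 0 := by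
  intro h
  apply det_confluent_pow_ne_zero he t ε ht hinj hε
  have h1 := congrArg φ h
  rw [map_zero, RingHom.map_det] at h1
  have h2 : φ.mapMatrix (Matrix.of fun c => if ε c then derivRow e (g c) else powRow e (g c)) =
      Complex.ofRealHom.mapMatrix
        (Matrix.of fun c a => if ε c then (e a : ℝ) * t c ^ (e a - 1) else t c ^ e a) := by
    ext c a
    rw [RingHom.mapMatrix_apply, RingHom.mapMatrix_apply, Matrix.map_apply, Matrix.map_apply]
    by_cases hc : ε c = true <;> simp [hc, powRow, derivRow, hφ]
  rw [h2, ← RingHom.map_det] at h1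
  exact Complex.ofReal_eq_zero.1 h1

/-- A square matrix over a domain is singular iff a nonzero vector is orthogonal to its rows. -/
theorem det_of_eq_zero_iff {κ A : Type*} [Fintype κ] [DecidableEq κ] [CommRing A] [IsDomain A]
    {u : κ → κ → A} : (Matrix.of u).det = 0 ↔ ∃ L : κ → A, L ≠ 0 ∧ ∀ c, u c ⬝ᵥ L = 0 := by
  rw [← Matrix.exists_mulVec_eq_zero_iff]
  refine exists_congr fun L => and_congr_right fun _ => ?_
  rw [funext_iff]
  rfl

theorem det_update_eq_sum {κ A : Type*} [Fintype κ] [DecidableEq κ] [CommRing A]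
    (u : κ → κ → A) (c : κ) (y : κ → A) :
    (Matrix.of (Function.update u c y)).det =
      ∑ l, y l * (Matrix.of (Function.update u c (Pi.single l 1))).det := by
  have h := (Matrix.detRowAlternating (R := A) (n := κ)).map_update_sum (t := Finset.univ) c
    (fun l => y l • (Pi.single l 1 : κ → A)) u
  have hy : ∑ l, y l • (Pi.single l 1 : κ → A) = y := by
    funext a
    simp [Finset.sum_apply, Pi.single_apply]
  rw [hy] at h
  refine h.trans (Finset.sum_congr rfl fun l _ => ?_)
  exact (Matrix.detRowAlternating (R := A) (n := κ)).map_update_smul u c (y l) (Pi.single l 1)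

theorem det_mem_subring {κ A : Type*} [Fintype κ] [DecidableEq κ] [CommRing A] (S : Subring A)
    (M : Matrix κ κ A) (hM : ∀ a b, M a b ∈ S) : M.det ∈ S := by
  rw [Matrix.det_apply]
  refine S.sum_mem fun τ _ => ?_
  rw [Units.smul_def]
  exact S.zsmul_mem (S.prod_mem fun b _ => hM _ _) _

/-- The elements killed by a derivation form a subring. -/
def Derivation.constants {B A : Type*} [CommRing B] [CommRing A] [Algebra B A]
    (D : Derivation B A A) : Subring A where
  carrier := {x | D x = 0}
  mul_mem' {x y} hx hy := by
    change D (x * y) = 0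
    rw [D.leibniz, show D x = 0 from hx, show D y = 0 from hy]; simp
  one_mem' := D.map_one_eq_zero
  add_mem' {x y} hx hy := by
    change D (x + y) = 0
    rw [map_add, show D x = 0 from hx, show D y = 0 from hy, add_zero]
  zero_mem' := map_zero D
  neg_mem' {x} hx := by
    change D (-x) = 0
    rw [map_neg, show D x = 0 from hx, neg_zero]

/-- A derivation killing all rows but one differentiates the determinant along that row. -/
theorem Derivation.det_update {B A κ : Type*} [Fintype κ] [DecidableEq κ] [CommRing B] [CommRing A]
    [Algebra B A] (D : Derivation B A A) (u : κ → κ → A) (c : κ)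
    (hu : ∀ b, b ≠ c → ∀ a, D (u b a) = 0) :
    D (Matrix.of u).det = (Matrix.of (Function.update u c fun a => D (u c a))).det := by
  have hconst : ∀ l, D (Matrix.of (Function.update u c (Pi.single l 1))).det = 0 := by
    intro l
    refine det_mem_subring D.constants _ fun b a => ?_
    change D (Function.update u c (Pi.single l 1) b a) = 0
    by_cases hb : b = c
    · subst hb
      rw [Function.update_self, Pi.single_apply]
      split_ifs <;> simp
    · rw [Function.update_of_ne hb]
      exact hu b hb a
  conv_lhs => rw [← Function.update_eq_self c u, det_update_eq_sum]
  rw [det_update_eq_sum, map_sum]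
  refine Finset.sum_congr rfl fun l _ => ?_
  rw [D.leibniz, hconst l]
  simp [mul_comm]

theorem pderiv_ne_zero_of_mem_vars {σ : Type*} {p : MvPolynomial σ ℂ} {i : σ} (hi : i ∈ p.vars) :
    pderiv i p ≠ 0 := by
  intro h
  obtain ⟨m, hm, him⟩ := mem_vars_iff_mem_support i |>.1 hi
  have hmi : m i ≠ 0 := Finsupp.mem_support_iff.1 him
  have h1 := coeff_pderiv (i := i) p (m - Finsupp.single i 1)
  have h2 : m - Finsupp.single i 1 + Finsupp.single i 1 = m := by
    ext a
    by_cases ha : a = i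
    · subst ha; simp; omega
    · simp [Ne.symm ha]
  rw [h, h2, coeff_zero] at h1
  have h3 := mem_support_iff.1 hm
  rcases mul_eq_zero.1 h1.symm with h4 | h4
  · exact h3 h4
  · norm_cast at h4

theorem vars_subset_of_dvd {σ : Type*} {p f : MvPolynomial σ ℂ} (hf : f ≠ 0) (h : p ∣ f) :
    p.vars ⊆ f.vars := by
  obtain ⟨g, rfl⟩ := h
  intro i hi
  rw [mem_vars_iff_degreeOf_ne_zero] at hi ⊢
  rw [degreeOf_mul_eq (left_ne_zero_of_mul hf) (right_ne_zero_of_mul hf)]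
  omega

theorem not_dvd_of_pderiv_eq_zero {σ : Type*} {p f : MvPolynomial σ ℂ} {i : σ} (hi : i ∈ p.vars)
    (hf : f ≠ 0) (hif : pderiv i f = 0) : ¬ p ∣ f :=
  fun h => pderiv_ne_zero_of_mem_vars (vars_subset_of_dvd hf h hi) hif

theorem not_dvd_pderiv {σ : Type*} {p : MvPolynomial σ ℂ} {i : σ} (hi : i ∈ p.vars) :
    ¬ p ∣ pderiv i p := by
  rintro ⟨g, hg⟩
  have h0 := pderiv_ne_zero_of_mem_vars hi
  have hp : p ≠ 0 := by rintro rfl; simp at h0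
  have hg0 : g ≠ 0 := by rintro rfl; simp [h0] at hg
  have h1 := degreeOf_mul_eq (n := i) hp hg0
  have h2 := mem_vars_iff_degreeOf_ne_zero.1 hi
  have h3 : degreeOf i (pderiv i p) < degreeOf i p := by
    rw [degreeOf_lt_iff (Nat.pos_of_ne_zero h2)]
    intro m hm
    have hm' := mem_support_iff.1 hm
    rw [coeff_pderiv] at hm'
    have h4 := le_degreeOf_of_mem_support i (mem_support_iff.2 (left_ne_zero_of_mul hm'))
    simp at h4
    omega
  rw [← hg] at h1
  omega

/-- The rows `0, powRow e x₁, …, powRow e x_k`. -/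
def powRows {A : Type*} [CommRing A] {k : ℕ} (e : Fin (k + 1) → ℕ) (x : Fin k → A) :
    Fin (k + 1) → Fin (k + 1) → A :=
  Fin.cons 0 fun b => powRow e (x b)

@[simp]
theorem powRows_succ {A : Type*} [CommRing A] {k : ℕ} (e : Fin (k + 1) → ℕ) (x : Fin k → A)
    (b : Fin k) : powRows e x b.succ = powRow e (x b) := rfl

theorem pderiv_powRow_X {σ κ : Type*} (e : κ → ℕ) (i : σ) (a : κ) :
    pderiv i (powRow e (X i : MvPolynomial σ ℂ) a) = derivRow e (X i) a := by
  simp [powRow, derivRow]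

theorem pderiv_powRow_X_of_ne {σ κ : Type*} (e : κ → ℕ) {i j : σ} (h : j ≠ i) (a : κ) :
    pderiv i (powRow e (X j : MvPolynomial σ ℂ) a) = 0 := by
  simp [powRow, pderiv_X_of_ne h]

theorem pderiv_derivRow_X_of_ne {σ κ : Type*} (e : κ → ℕ) {i j : σ} (h : j ≠ i) (a : κ) :
    pderiv i (derivRow e (X j : MvPolynomial σ ℂ) a) = 0 := by
  have : (e a : MvPolynomial σ ℂ) = C (e a : ℂ) := by simp
  rw [derivRow, this, pderiv_C_mul]
  simp [pderiv_X_of_ne h]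

/-- If `p` divides all maximal minors of the matrix of powers, then it also divides the
determinants in which the derivatives along two variables are inserted. -/
theorem dvd_det_derivRow {k : ℕ} {e : Fin (k + 1) → ℕ} {p : MvPolynomial (Fin k) ℂ}
    (hp : Prime p)
    (hdvd : ∀ l, p ∣ (Matrix.of (Function.update (powRows e X) 0 (Pi.single l 1))).det)
    {i : Fin k} (j : Fin k) (hi : i ∈ p.vars) :
    p ∣ (Matrix.of (Function.update (Function.update (powRows e X) 0 (derivRow e (X i))) j.succ
      (derivRow e (X j)))).det := by
  have hD : ∀ (j : Fin k) l,
      pderiv j (Matrix.of (Function.update (powRows e (X : Fin k → MvPolynomial (Fin k) ℂ)) 0 (Pi.single l 1))).det =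
      (Matrix.of (Function.update (Function.update (powRows e (X : Fin k → MvPolynomial (Fin k) ℂ)) 0
        (Pi.single l 1)) j.succ (derivRow e (X j)))).det := by
    intro j l
    rw [Derivation.det_update (pderiv j) _ j.succ]
    · congr 3
      funext a
      rw [Function.update_of_ne (Fin.succ_ne_zero j), powRows_succ, pderiv_powRow_X]
    · intro b hb a
      induction b using Fin.cases with
      | zero =>
        rw [Function.update_self, Pi.single_apply]
        split_ifs <;> simp
      | succ b =>
        rw [Function.update_of_ne (Fin.succ_ne_zero b), powRows_succ, pderiv_powRow_X_of_ne]
        rintro rfl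
        exact hb rfl
  have hexp : ∀ (j : Fin k),
      (Matrix.of (Function.update (Function.update (powRows e (X : Fin k → MvPolynomial (Fin k) ℂ)) 0
        (derivRow e (X i))) j.succ (derivRow e (X j)))).det =
      ∑ l, derivRow e (X i) l *
        pderiv j (Matrix.of (Function.update (powRows e (X : Fin k → MvPolynomial (Fin k) ℂ)) 0 (Pi.single l 1))).det := by
    intro j
    rw [Function.update_comm (Fin.succ_ne_zero j).symm, det_update_eq_sum]
    refine Finset.sum_congr rfl fun l _ => ?_
    rw [hD, Function.update_comm (Fin.succ_ne_zero j).symm]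
  have hrep : ∑ l, derivRow e (X i) l *
        pderiv i (Matrix.of (Function.update (powRows e (X : Fin k → MvPolynomial (Fin k) ℂ)) 0 (Pi.single l 1))).det = 0 := by
    rw [← hexp i]
    refine Matrix.det_zero_of_row_eq (i := 0) (j := i.succ) (Fin.succ_ne_zero i).symm ?_
    funext a
    rw [Matrix.of_apply, Matrix.of_apply, Function.update_self, Function.update_of_ne (Fin.succ_ne_zero i).symm, Function.update_self]
  choose u hu using hdvd
  have key : (∑ l, derivRow e (X i) l *
        pderiv j (Matrix.of (Function.update (powRows e (X : Fin k → MvPolynomial (Fin k) ℂ)) 0 (Pi.single l 1))).det) * pderiv i p =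
      p * ∑ l, derivRow e (X i) l * (pderiv j (u l) * pderiv i p - pderiv i (u l) * pderiv j p) := by
    have h0 : (∑ l, derivRow e (X i) l *
        pderiv i (Matrix.of (Function.update (powRows e (X : Fin k → MvPolynomial (Fin k) ℂ)) 0 (Pi.single l 1))).det) * pderiv j p = 0 := by
      rw [hrep, zero_mul]
    refine (sub_zero _).symm.trans ?_
    rw [← h0, Finset.sum_mul, Finset.sum_mul, ← Finset.sum_sub_distrib, Finset.mul_sum]
    refine Finset.sum_congr rfl fun l _ => ?_
    rw [hu l, pderiv_mul, pderiv_mul]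
    ring
  rw [hexp j]
  exact (hp.dvd_or_dvd (Dvd.intro _ key.symm)).resolve_right (not_dvd_pderiv hi)

/-- If all minors of a matrix with generic rows vanish in a domain, a vector orthogonal to all
power rows but one is orthogonal to all of them. -/
theorem dotProduct_eq_zero_of_det_eq_zero {κ A : Type*} [Fintype κ] [DecidableEq κ] [CommRing A]
    [IsDomain A] (u : κ → κ → A) {c d : κ} (hcd : c ≠ d) (z : κ → A)
    (hu : (Matrix.of u).det ≠ 0)
    (hz : ∀ y, (Matrix.of (Function.update (Function.update u c z) d y)).det = 0)
    (L : κ → A) (hL : ∀ b, b ≠ c → b ≠ d → u b ⬝ᵥ L = 0) : z ⬝ᵥ L = 0 := by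
  have h := Matrix.mulVec_cramer (Matrix.of u).transpose z
  have h1 : (Matrix.of u).transpose.mulVec ((Matrix.of u).transpose.cramer z) ⬝ᵥ L =
      ∑ b, (Matrix.of u).transpose.cramer z b * (u b ⬝ᵥ L) := by
    rw [Matrix.mulVec_transpose, ← Matrix.dotProduct_mulVec]
    rfl
  rw [h, smul_dotProduct, smul_eq_mul, Matrix.det_transpose] at h1
  refine (mul_eq_zero.1 (h1.trans (Finset.sum_eq_zero fun b _ => ?_))).resolve_left hu
  rw [Matrix.cramer_transpose_apply]
  by_cases hbc : b = c
  · subst hbc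
    have h2 := hz (u d)
    rw [Function.update_comm hcd, Function.update_eq_self] at h2
    rw [show (Matrix.of u).updateRow b z = Matrix.of (Function.update u b z) from rfl, h2, zero_mul]
  by_cases hbd : b = d
  · subst hbd
    have h2 := hz (u c)
    have h3 := Matrix.det_permute (Equiv.swap c b)
      (Matrix.of (Function.update (Function.update u c z) b (u c)))
    rw [h2, mul_zero] at h3
    have h4 : (Matrix.of (Function.update (Function.update u c z) b (u c))).submatrix
        (Equiv.swap c b) id = (Matrix.of u).updateRow b z := by
      ext a l
      change Function.update (Function.update u c z) b (u c) (Equiv.swap c b a) l =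
        Function.update u b z a l
      by_cases ha : a = b
      · subst ha
        rw [Equiv.swap_apply_right, Function.update_of_ne hcd, Function.update_self,
          Function.update_self]
      by_cases ha' : a = c
      · subst ha'
        rw [Equiv.swap_apply_left, Function.update_self, Function.update_of_ne hcd]
      · rw [Equiv.swap_apply_of_ne_of_ne ha' ha, Function.update_of_ne ha, Function.update_of_ne ha',
          Function.update_of_ne ha]
    rw [← h4, h3, zero_mul]
  · rw [hL b hbc hbd, mul_zero]

theorem map_det_of {κ A B : Type*} [Fintype κ] [DecidableEq κ] [CommRing A] [CommRing B]
    (φ : A →+* B) (u : κ → κ → A) :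
    φ (Matrix.of u).det = (Matrix.of fun c a => φ (u c a)).det := by
  rw [RingHom.map_det]
  rfl

theorem map_update_row {κ A B : Type*} [DecidableEq κ] (φ : A → B) (u : κ → κ → A) (c : κ)
    (y : κ → A) : (fun b a => φ (Function.update u c y b a)) =
      Function.update (fun b a => φ (u b a)) c fun a => φ (y a) := by
  funext b a
  by_cases hb : b = c
  · subst hb; simp
  · simp [Function.update_of_ne hb]

theorem det_two_derivRow_ne_zero {k : ℕ} {e : Fin (k + 1) → ℕ} (he : Function.Injective e)
    {i j q : Fin k} (hij : i ≠ j) (hiq : i ≠ q) (hjq : j ≠ q) :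
    (Matrix.of (Function.update (Function.update
      (powRows e (X : Fin k → MvPolynomial (Fin k) ℂ)) 0 (derivRow e (X i))) q.succ
      (derivRow e (X j)))).det ≠ 0 := by
  have := det_confluent_ne_zero he (eval fun b : Fin k => (b : ℂ) + 2)
    (Function.update (Fin.cons (X i) X) q.succ (X j))
    (Function.update (Fin.cons ((i : ℝ) + 2) (fun b : Fin k => (b : ℝ) + 2)) q.succ ((j : ℝ) + 2))
    (fun c => decide (c = 0 ∨ c = q.succ)) ?_ ?_ ?_ ?_
  · convert this using 3
    funext c
    by_cases hc : c = q.succ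
    · subst hc; simp
    · rw [Function.update_of_ne hc, Function.update_of_ne hc]
      induction c using Fin.cases with
      | zero => simp
      | succ b =>
        have : b ≠ q := by simpa using hc
        simp [this]
  · intro c
    by_cases hc : c = q.succ
    · subst hc; simp
    · rw [Function.update_of_ne hc, Function.update_of_ne hc]
      induction c using Fin.cases <;> simp
  · intro c
    by_cases hc : c = q.succ
    · subst hc; simp; positivity
    · rw [Function.update_of_ne hc]
      induction c using Fin.cases <;> simp <;> positivity
  · intro c d hcd
    have hne : (i : ℕ) ≠ j := fun h => hij (Fin.ext h)
    simp only [Prod.mk.injEq, decide_eq_decide] at hcd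
    obtain ⟨h2, h3⟩ := hcd
    by_cases hc : c = q.succ <;> by_cases hd : d = q.succ
    · rw [hc, hd]
    · subst hc
      rw [Function.update_self, Function.update_of_ne hd] at h2
      induction d using Fin.cases with
      | zero =>
        simp at h2
        exact absurd h2.symm hne
      | succ d => simp [hd] at h3
    · subst hd
      rw [Function.update_self, Function.update_of_ne hc] at h2
      induction c using Fin.cases with
      | zero =>
        simp at h2
        exact absurd h2 hne
      | succ c => simp [hc] at h3
    · rw [Function.update_of_ne hd, Function.update_of_ne hc] at h2
      simp only [hc, hd, or_false] at h3
      induction c using Fin.cases with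
      | zero => exact (h3.1 rfl).symm
      | succ c =>
        induction d using Fin.cases with
        | zero => exact h3.2 rfl
        | succ d => simpa [Fin.ext_iff] using h2
  · intro c hc
    simp only [decide_eq_true_eq] at hc
    rcases hc with rfl | rfl
    · refine ⟨i.succ, ?_, ?_⟩
      · rw [Function.update_of_ne (by simpa using hiq), Function.update_of_ne (Fin.succ_ne_zero q).symm]
        simp
      · simpa using hiq
    · refine ⟨j.succ, ?_, ?_⟩
      · rw [Function.update_of_ne (by simpa using hjq), Function.update_self]
        simp
      · simpa using hjq

theorem not_dvd_det_const_rows {k : ℕ} {e : Fin (k + 1) → ℕ} (he : Function.Injective e)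
    {p : MvPolynomial (Fin k) ℂ} {j : Fin k} (hj : j ∈ p.vars) :
    ¬ p ∣ (Matrix.of (Function.update (Function.update (powRows e X) 0 (powRow e (C 1))) j.succ
      (powRow e (C ((j : ℂ) + 2))))).det := by
  refine not_dvd_of_pderiv_eq_zero hj ?_ ?_
  · have := det_confluent_ne_zero he (eval fun b : Fin k => (b : ℂ) + 2)
      (Function.update (Fin.cons (C 1) X) j.succ (C ((j : ℂ) + 2)))
      (fun c => (c : ℝ) + 1) (fun _ => false) ?_ (fun c => by positivity) ?_ (by simp)
    · convert this using 3
      funext c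
      simp only [Bool.false_eq_true, if_false]
      by_cases hc : c = j.succ
      · subst hc; simp
      · rw [Function.update_of_ne hc, Function.update_of_ne hc]
        induction c using Fin.cases <;> simp
    · intro c
      by_cases hc : c = j.succ
      · subst hc; simp; ring
      · rw [Function.update_of_ne hc]
        induction c using Fin.cases with
        | zero => simp
        | succ b => simp; ring
    · intro c d hcd
      simpa [Fin.ext_iff] using hcd
  · refine det_mem_subring (pderiv j).constants _ fun b a => ?_
    change pderiv j (Function.update (Function.update (powRows e X) 0 (powRow e (C 1))) j.succ
      (powRow e (C ((j : ℂ) + 2))) b a) = 0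
    by_cases hb : b = j.succ
    · subst hb
      simp [powRow]
    · rw [Function.update_of_ne hb]
      induction b using Fin.cases with
      | zero => simp [powRow]
      | succ b =>
        rw [Function.update_of_ne (Fin.succ_ne_zero b), powRows_succ, pderiv_powRow_X_of_ne]
        rintro rfl
        exact hb rfl

/-- A prime dividing all maximal minors of the matrix of powers involves at most two variables. -/
theorem not_three_vars {k : ℕ} {e : Fin (k + 1) → ℕ} (he : Function.Injective e)
    {p : MvPolynomial (Fin k) ℂ} (hp : Prime p)
    (hdvd : ∀ l, p ∣ (Matrix.of (Function.update (powRows e X) 0 (Pi.single l 1))).det)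
    {i j q : Fin k} (hij : i ≠ j) (hiq : i ≠ q) (hjq : j ≠ q) (hi : i ∈ p.vars) (hj : j ∈ p.vars)
    (hq : q ∈ p.vars) : False := by
  set π := Ideal.Quotient.mk (Ideal.span {p}) with hπ
  have hπ0 : ∀ x, π x = 0 ↔ p ∣ x := fun x => by
    rw [hπ, Ideal.Quotient.eq_zero_iff_mem, Ideal.mem_span_singleton]
  have : (Ideal.span {p}).IsPrime := (Ideal.span_singleton_prime hp.ne_zero).2 hp
  have h1 := (hπ0 _).2 (dvd_det_derivRow hp hdvd j hi)
  rw [map_det_of, map_update_row, map_update_row] at h1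
  obtain ⟨L, hL0, hL⟩ := det_of_eq_zero_iff.1 h1
  have hv : ∀ b, b ≠ j → (fun a => π (powRow e (X b) a)) ⬝ᵥ L = 0 := by
    intro b hb
    have := hL b.succ
    rwa [Function.update_of_ne (by simpa using hb), Function.update_of_ne (Fin.succ_ne_zero b),
      powRows_succ] at this
  have hwj : (fun a => π (derivRow e (X j) a)) ⬝ᵥ L = 0 := by
    have := hL j.succ
    rwa [Function.update_self] at this
  have hwi : (fun a => π (derivRow e (X i) a)) ⬝ᵥ L = 0 := by
    have := hL 0
    rwa [Function.update_of_ne (Fin.succ_ne_zero j).symm, Function.update_self] at this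
  have hvj : (fun a => π (powRow e (X j) a)) ⬝ᵥ L = 0 := by
    set uu : Fin (k + 1) → Fin (k + 1) → MvPolynomial (Fin k) ℂ :=
      Function.update (Function.update (powRows e X) 0 (powRow e (C 1))) j.succ
        (powRow e (C ((j : ℂ) + 2))) with huu
    refine dotProduct_eq_zero_of_det_eq_zero (fun c a => π (uu c a)) (Fin.succ_ne_zero j) _ ?_ ?_ L ?_
    · rw [← map_det_of, Ne, hπ0]
      exact not_dvd_det_const_rows he hj
    · intro y
      rw [det_update_eq_sum]
      refine Finset.sum_eq_zero fun l _ => ?_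
      have h2 := (hπ0 _).2 (hdvd l)
      rw [map_det_of, map_update_row] at h2
      refine mul_eq_zero_of_right _ ?_
      rw [← h2]
      congr 2
      funext c
      by_cases hc : c = 0
      · subst hc
        rw [Function.update_self, Function.update_self]
        funext a
        by_cases hal : a = l <;> simp [hal]
      · rw [Function.update_of_ne hc, Function.update_of_ne hc]
        by_cases hcj : c = j.succ
        · subst hcj; simp
        · rw [Function.update_of_ne hcj, huu, Function.update_of_ne hcj, Function.update_of_ne hc]
    · intro c hcj hc0
      obtain ⟨b, rfl⟩ := Fin.exists_succ_eq.2 hc0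
      rw [huu, Function.update_of_ne hcj, Function.update_of_ne hc0, powRows_succ]
      refine hv b ?_
      rintro rfl
      exact hcj rfl
  set ww : Fin (k + 1) → Fin (k + 1) → MvPolynomial (Fin k) ℂ :=
    Function.update (Function.update (powRows e X) 0 (derivRow e (X i))) q.succ
      (derivRow e (X j)) with hww
  have hdw : p ∣ (Matrix.of ww).det := by
    rw [← hπ0, map_det_of, det_of_eq_zero_iff]
    refine ⟨L, hL0, fun c => ?_⟩
    change (fun a => π (ww c a)) ⬝ᵥ L = 0
    by_cases hcq : c = q.succ
    · have h : ww c = derivRow e (X j) := by rw [hcq, hww, Function.update_self]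
      rw [h]
      exact hwj
    · induction c using Fin.cases with
      | zero =>
        have h : ww 0 = derivRow e (X i) := by
          rw [hww, Function.update_of_ne hcq, Function.update_self]
        rw [h]
        exact hwi
      | succ b =>
        have h : ww b.succ = powRow e (X b) := by
          rw [hww, Function.update_of_ne hcq, Function.update_of_ne (Fin.succ_ne_zero b),
            powRows_succ]
        rw [h]
        by_cases hb : b = j
        · subst hb; exact hvj
        · exact hv b hb
  refine not_dvd_of_pderiv_eq_zero hq ?_ ?_ hdw
  · exact det_two_derivRow_ne_zero he hij hiq hjq
  · refine det_mem_subring (pderiv q).constants _ fun b a => ?_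
    change pderiv q (ww b a) = 0
    by_cases hb : b = q.succ
    · subst hb
      rw [hww, Function.update_self, pderiv_derivRow_X_of_ne _ hjq]
    · rw [hww, Function.update_of_ne hb]
      induction b using Fin.cases with
      | zero => rw [Function.update_self, pderiv_derivRow_X_of_ne _ hiq]
      | succ b =>
        rw [Function.update_of_ne (Fin.succ_ne_zero b), powRows_succ, pderiv_powRow_X_of_ne]
        rintro rfl
        exact hb rfl

/-- A prime dividing all maximal minors of the matrix of powers still divides them after rows of
variables not involved in the prime are replaced by constants. -/
theorem dvd_det_const_rows {k : ℕ} {e : Fin (k + 1) → ℕ} (he : Function.Injective e)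
    {p : MvPolynomial (Fin k) ℂ}
    (hdvd : ∀ l, p ∣ (Matrix.of (Function.update (powRows e X) 0 (Pi.single l 1))).det)
    (U : Finset (Fin k)) (hU : ∀ b ∈ U, b ∉ p.vars) (Y : Fin (k + 1) → Fin (k + 1) → ℂ) :
    p ∣ (Matrix.of (Fin.cons (fun a => C (Y 0 a)) fun b =>
      if b ∈ U then fun a => C (Y b.succ a) else powRow e (X b) :
        Fin (k + 1) → Fin (k + 1) → MvPolynomial (Fin k) ℂ)).det := by
  induction U using Finset.induction_on with
  | empty =>
    have : (Fin.cons (fun a => C (Y 0 a)) fun b =>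
      if b ∈ (∅ : Finset (Fin k)) then fun a => C (Y b.succ a) else powRow e (X b) :
        Fin (k + 1) → Fin (k + 1) → MvPolynomial (Fin k) ℂ) =
        Function.update (powRows e X) 0 fun a => C (Y 0 a) := by
      simp [powRows]
    rw [this, det_update_eq_sum]
    exact Finset.dvd_sum fun l _ => (hdvd l).mul_left _
  | insert b U hbU ih =>
    have ih := ih fun c hc => hU c (Finset.mem_insert_of_mem hc)
    set R : Fin (k + 1) → Fin (k + 1) → MvPolynomial (Fin k) ℂ := Fin.cons (fun a => C (Y 0 a))
      fun b => if b ∈ U then fun a => C (Y b.succ a) else powRow e (X b) with hR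
    have hupd : (Fin.cons (fun a => C (Y 0 a)) fun c =>
        if c ∈ insert b U then fun a => C (Y c.succ a) else powRow e (X c) :
          Fin (k + 1) → Fin (k + 1) → MvPolynomial (Fin k) ℂ) =
        Function.update R b.succ fun a => C (Y b.succ a) := by
      rw [hR, ← Fin.cons_update]
      congr 1
      funext c
      by_cases hc : c = b
      · subst hc; simp
      · simp [hc]
    have heval : ∀ t : ℂ, p ∣ (Matrix.of (Function.update R b.succ (powRow e (C t)))).det := by
      intro t
      set ψ : MvPolynomial (Fin k) ℂ →ₐ[ℂ] MvPolynomial (Fin k) ℂ :=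
        aeval (Function.update X b (C t)) with hψ
      have hψp : ψ p = p := by
        have h1 : ψ p = aeval X p := by
          refine eval₂Hom_congr' rfl (fun c hc _ => Function.update_of_ne ?_ _ _) rfl
          rintro rfl
          exact hU c (Finset.mem_insert_self _ _) hc
        rw [h1, aeval_X_left, AlgHom.id_apply]
      have h2 : (ψ : MvPolynomial (Fin k) ℂ →+* MvPolynomial (Fin k) ℂ) (Matrix.of R).det =
          (Matrix.of (Function.update R b.succ (powRow e (C t)))).det := by
        rw [map_det_of]
        congr 2
        funext c
        by_cases hc : c = b.succ
        · subst hc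
          rw [Function.update_self]
          funext a
          simp [hR, hbU, powRow, hψ]
        · rw [Function.update_of_ne hc]
          funext a
          induction c using Fin.cases with
          | zero => simp [hR, hψ, ← algebraMap_eq]
          | succ c =>
            have hcb : c ≠ b := fun h => hc (by rw [h])
            by_cases hcU : c ∈ U
            · simp [hR, hcU, hψ, ← algebraMap_eq]
            · simp [hR, hcU, hψ, powRow, hcb]
      rw [← h2]
      have h3 := map_dvd (ψ : MvPolynomial (Fin k) ℂ →+* MvPolynomial (Fin k) ℂ) ih
      rwa [show (ψ : MvPolynomial (Fin k) ℂ →+* MvPolynomial (Fin k) ℂ) p = p from hψp] at h3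
    set V : Matrix (Fin (k + 1)) (Fin (k + 1)) ℂ :=
      Matrix.of fun c => powRow e ((c : ℂ) + 1) with hV
    have hVdet : V.det ≠ 0 := by
      have := det_confluent_ne_zero he (RingHom.id ℂ) (fun c : Fin (k + 1) => (c : ℂ) + 1)
        (fun c => (c : ℝ) + 1) (fun _ => false) (by simp) (fun c => by positivity)
        (fun c d hcd => by simpa [Fin.ext_iff] using hcd) (by simp)
      simpa using this
    have hcomb : ∃ α : Fin (k + 1) → ℂ, Y b.succ = ∑ c, α c • powRow e ((c : ℂ) + 1) := by
      refine ⟨Matrix.vecMul (Y b.succ) V⁻¹, ?_⟩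
      have h4 : Matrix.vecMul (Matrix.vecMul (Y b.succ) V⁻¹) V = Y b.succ := by
        rw [Matrix.vecMul_vecMul, Matrix.nonsing_inv_mul _ (isUnit_iff_ne_zero.2 hVdet),
          Matrix.vecMul_one]
      refine h4.symm.trans ?_
      funext a
      simp [Matrix.vecMul, dotProduct, hV]
    obtain ⟨α, hα⟩ := hcomb
    have hrow : (fun a => C (Y b.succ a) : Fin (k + 1) → MvPolynomial (Fin k) ℂ) =
        ∑ c : Fin (k + 1), (C (α c) : MvPolynomial (Fin k) ℂ) •
          powRow e (C ((c : ℂ) + 1) : MvPolynomial (Fin k) ℂ) := by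
      funext a
      rw [hα]
      simp [powRow]
    rw [hupd, hrow]
    have h5 := (Matrix.detRowAlternating (R := MvPolynomial (Fin k) ℂ)
      (n := Fin (k + 1))).map_update_sum (t := Finset.univ) b.succ
      (fun c : Fin (k + 1) => (C (α c) : MvPolynomial (Fin k) ℂ) •
        powRow e (C ((c : ℂ) + 1) : MvPolynomial (Fin k) ℂ)) R
    refine dvd_trans (Finset.dvd_sum fun c _ => ?_) (dvd_of_eq h5.symm)
    rw [AlternatingMap.map_update_smul]
    exact (heval _).mul_left _

theorem eq_of_pow_eq_of_gcd_eq_one {D ι : Type*} [CommRing D] [IsDomain D] {x y : D} (S : Finset ι)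
    (n : ι → ℕ) (hn : S.gcd n = 1) (h : ∀ a ∈ S, x ^ n a = y ^ n a) : x = y := by
  obtain ⟨a, ha, hna⟩ : ∃ a ∈ S, n a ≠ 0 := by
    by_contra! hne
    rw [Finset.gcd_eq_zero_iff.2 hne] at hn
    exact zero_ne_one hn
  by_cases hy : y = 0
  · subst hy
    have := h a ha
    rw [zero_pow hna] at this
    exact pow_eq_zero_iff hna |>.1 this
  · let ι' := algebraMap D (FractionRing D)
    have hinj : Function.Injective ι' := IsFractionRing.injective D (FractionRing D)
    have hy' : ι' y ≠ 0 := fun h0 => hy (hinj (by rw [h0, map_zero]))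
    have hz : orderOf (ι' x / ι' y) ∣ S.gcd n := by
      refine Finset.dvd_gcd fun b hb => orderOf_dvd_of_pow_eq_one ?_
      rw [div_pow, ← map_pow, h b hb, map_pow, div_self (pow_ne_zero _ hy')]
    rw [hn, Nat.dvd_one, orderOf_eq_one_iff, div_eq_one_iff_eq hy'] at hz
    exact hinj hz

/-- If a prime divides all maximal minors of the matrix of powers and the exponents are coprime,
then it divides a difference of two variables. -/
theorem exists_dvd_X_sub_X {k : ℕ} (hk : 2 ≤ k) {e : Fin (k + 1) → ℕ} (he : Function.Injective e)
    (he0 : e 0 = 0) (hgcd : Finset.gcd (Finset.Ioi (0 : Fin (k + 1))) e = 1)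
    {p : MvPolynomial (Fin k) ℂ} (hp : Prime p)
    (hdvd : ∀ l, p ∣ (Matrix.of (Function.update (powRows e X) 0 (Pi.single l 1))).det) :
    ∃ i j : Fin k, i ≠ j ∧ p ∣ X i - X j := by
  by_cases hcard : 2 < p.vars.card
  · obtain ⟨i, hi, j, hj, q, hq, hij, hiq, hjq⟩ := Finset.two_lt_card.1 hcard
    exact (not_three_vars he hp hdvd hij hiq hjq hi hj hq).elim
  obtain ⟨T, hT, hT2⟩ := Finset.exists_superset_card_eq (not_lt.1 hcard) (by simpa using hk)
  obtain ⟨i, j, hij, rfl⟩ := Finset.card_eq_two.1 hT2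
  refine ⟨i, j, hij, ?_⟩
  set π := Ideal.Quotient.mk (Ideal.span {p}) with hπ
  have hπ0 : ∀ x, π x = 0 ↔ p ∣ x := fun x => by
    rw [hπ, Ideal.Quotient.eq_zero_iff_mem, Ideal.mem_span_singleton]
  have : (Ideal.span {p}).IsPrime := (Ideal.span_singleton_prime hp.ne_zero).2 hp
  rw [← hπ0, map_sub, sub_eq_zero]
  refine eq_of_pow_eq_of_gcd_eq_one _ e hgcd fun a ha => ?_
  have ha0 : a ≠ 0 := (Finset.mem_Ioi.1 ha).ne'
  have hijs : i.succ ≠ j.succ := by simpa using hij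
  set τ : Equiv.Perm (Fin (k + 1)) := Equiv.swap j.succ a * Equiv.swap i.succ 0 with hτ
  have hτi : τ i.succ = 0 := by
    rw [hτ, Equiv.Perm.mul_apply, Equiv.swap_apply_left,
      Equiv.swap_apply_of_ne_of_ne (Fin.succ_ne_zero j).symm ha0.symm]
  have hτj : τ j.succ = a := by
    rw [hτ, Equiv.Perm.mul_apply, Equiv.swap_apply_of_ne_of_ne hijs.symm (Fin.succ_ne_zero j),
      Equiv.swap_apply_left]
  have h1 := (hπ0 _).2 (dvd_det_const_rows he hdvd (Finset.univ \ {i, j})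
    (fun b hb hbp => (Finset.mem_sdiff.1 hb).2 (hT hbp)) (fun c => Pi.single (τ c) 1))
  rw [map_det_of] at h1
  obtain ⟨L, hL0, hL⟩ := det_of_eq_zero_iff.1 h1
  have hLτ : ∀ c, c ≠ i.succ → c ≠ j.succ → L (τ c) = 0 := by
    intro c hci hcj
    have h2 := hL c
    rw [dotProduct, Finset.sum_eq_single (τ c)] at h2
    · induction c using Fin.cases with
      | zero => simpa using h2
      | succ c =>
        have h3 : c ∈ Finset.univ \ {i, j} := by
          simp only [Finset.mem_sdiff, Finset.mem_univ, true_and, Finset.mem_insert,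
            Finset.mem_singleton]
          rintro (rfl | rfl)
          · exact hci rfl
          · exact hcj rfl
        simp only [Fin.cons_succ, h3, if_true, Pi.single_eq_same, map_one, one_mul] at h2
        exact h2
    · intro b _ hb
      induction c using Fin.cases with
      | zero => simp [hb]
      | succ c =>
        have h3 : c ∈ Finset.univ \ {i, j} := by
          simp only [Finset.mem_sdiff, Finset.mem_univ, true_and, Finset.mem_insert,
            Finset.mem_singleton]
          rintro (rfl | rfl)
          · exact hci rfl
          · exact hcj rfl
        simp only [Fin.cons_succ, h3, if_true, Pi.single_eq_of_ne hb, map_zero, zero_mul]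
    · simp
  have hLb : ∀ b, b ≠ 0 → b ≠ a → L b = 0 := by
    intro b hb0 hba
    rw [← τ.apply_symm_apply b]
    refine hLτ _ ?_ ?_
    · rw [Ne, Equiv.symm_apply_eq, hτi]; exact hb0
    · rw [Ne, Equiv.symm_apply_eq, hτj]; exact hba
  have hrow : ∀ c ∈ ({i, j} : Finset (Fin k)), L 0 + π (X c) ^ e a * L a = 0 := by
    intro c hc
    have h2 := hL c.succ
    have h3 : c ∉ Finset.univ \ {i, j} := fun h => (Finset.mem_sdiff.1 h).2 hc
    simp only [Fin.cons_succ, h3, if_false, powRow, map_pow] at h2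
    rw [dotProduct, ← Finset.sum_subset (Finset.subset_univ {0, a}), Finset.sum_pair ha0.symm, he0,
      pow_zero, one_mul] at h2
    · exact h2
    · intro b _ hb
      simp only [Finset.mem_insert, Finset.mem_singleton, not_or] at hb
      rw [hLb b hb.1 hb.2, mul_zero]
  have hi := hrow i (by simp)
  have hj := hrow j (by simp)
  have hLa : L a ≠ 0 := by
    intro h0
    apply hL0
    funext b
    rw [h0, mul_zero, add_zero] at hi
    by_cases hb0 : b = 0
    · rw [hb0, hi]; rfl
    by_cases hba : b = a
    · rw [hba, h0]; rfl
    · exact hLb b hb0 hba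
  exact mul_right_cancel₀ hLa (add_left_cancel (hi.trans hj.symm))

theorem coeff_prod_mk_pow {A : Type*} [CommRing A] {k : ℕ} (x : Fin k → A) (n : ℕ) :
    PowerSeries.coeff n (∏ c, PowerSeries.mk fun m => x c ^ m) =
      ∑ μ ∈ Finset.Nat.antidiagonalTuple k n, ∏ b, x b ^ μ b := by
  rw [PowerSeries.coeff_prod]
  refine Finset.sum_bij' (fun l _ => ⇑l) (fun μ _ => Finsupp.equivFunOnFinite.symm μ) ?_ ?_ ?_ ?_ ?_
  · intro l hl
    rw [Finset.mem_finsuppAntidiag] at hl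
    exact Finset.Nat.mem_antidiagonalTuple.2 hl.1
  · intro μ hμ
    rw [Finset.mem_finsuppAntidiag]
    exact ⟨Finset.Nat.mem_antidiagonalTuple.1 hμ, Finset.subset_univ _⟩
  · intro l _
    ext; rfl
  · intro μ _
    rfl
  · intro l _
    simp

theorem mk_pow_mul_one_sub {A : Type*} [CommRing A] (x : A) :
    (PowerSeries.mk fun m => x ^ m) * (1 - PowerSeries.C x * PowerSeries.X) = 1 := by
  have h := congrArg (PowerSeries.rescale x) (PowerSeries.mk_one_mul_one_sub_eq_one A)
  rw [map_mul, map_sub, map_one, PowerSeries.rescale_X] at h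
  refine Eq.trans ?_ h
  congr 1
  ext n
  simp

/-- The generating function of the complete homogeneous symmetric polynomials of `θ x₁, …, θ x_k`. -/
noncomputable def completeHomogSeries {A : Type*} [CommRing A] {k : ℕ}
    (θ : MvPolynomial (Fin k) ℂ →+* A) : PowerSeries A :=
  PowerSeries.mk fun n => θ (completeHomog k n)

theorem completeHomogSeries_eq_prod {A : Type*} [CommRing A] {k : ℕ}
    (θ : MvPolynomial (Fin k) ℂ →+* A) :
    completeHomogSeries θ = ∏ c, PowerSeries.mk fun m => θ (X c) ^ m := by
  ext n
  rw [coeff_prod_mk_pow, completeHomogSeries, PowerSeries.coeff_mk, completeHomog,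
    if_pos (Int.natCast_nonneg n), Int.toNat_natCast]
  simp

theorem coeff_completeHomogSeries_mul {A : Type*} [CommRing A] {k : ℕ}
    (θ : MvPolynomial (Fin k) ℂ →+* A) (g : Polynomial A) (hg : g.natDegree < k) (n : ℕ) :
    PowerSeries.coeff n (completeHomogSeries θ * (g : PowerSeries A)) =
      ∑ b : Fin k, g.coeff (k - 1 - b) * θ (completeHomog k ((n : ℤ) - ((k : ℤ) - 1 - (b : ℕ)))) := by
  have h1 : ∀ b : Fin k, g.coeff (k - 1 - b) *
      θ (completeHomog k ((n : ℤ) - ((k : ℤ) - 1 - (b : ℕ)))) =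
      (fun m : ℕ => g.coeff m * θ (completeHomog k ((n : ℤ) - m))) (Fin.revPerm b : Fin k) := by
    intro b
    have := b.isLt
    have h2 : ((Fin.revPerm b : Fin k) : ℕ) = k - 1 - b := by simp; omega
    simp only [h2]
    congr 3
    omega
  rw [Finset.sum_congr rfl fun b _ => h1 b,
    Equiv.sum_comp Fin.revPerm fun b : Fin k =>
      (fun m : ℕ => g.coeff m * θ (completeHomog k ((n : ℤ) - m))) b,
    Fin.sum_univ_eq_sum_range fun m : ℕ => g.coeff m * θ (completeHomog k ((n : ℤ) - m)),
    mul_comm (completeHomogSeries θ), PowerSeries.coeff_mul,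
    Finset.Nat.sum_antidiagonal_eq_sum_range_succ
      (fun a b => PowerSeries.coeff a (g : PowerSeries A) *
        PowerSeries.coeff b (completeHomogSeries θ))]
  have h3 : ∀ m ∈ Finset.range n.succ, PowerSeries.coeff m (g : PowerSeries A) *
        PowerSeries.coeff (n - m) (completeHomogSeries θ) =
        g.coeff m * θ (completeHomog k ((n : ℤ) - m)) := by
    intro m hm
    rw [Finset.mem_range] at hm
    rw [Polynomial.coeff_coe, completeHomogSeries, PowerSeries.coeff_mk, Nat.cast_sub (by omega)]
  rw [Finset.sum_congr rfl h3]
  have h4 : ∀ s ≤ k + n.succ, (∀ m, s ≤ m →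
      g.coeff m * θ (completeHomog k ((n : ℤ) - m)) = 0) →
      ∑ m ∈ Finset.range s, g.coeff m * θ (completeHomog k ((n : ℤ) - m)) =
      ∑ m ∈ Finset.range (k + n.succ), g.coeff m * θ (completeHomog k ((n : ℤ) - m)) :=
    fun s hs h0 => Finset.sum_subset (Finset.range_mono hs) fun m _ hm => h0 m (by simpa using hm)
  rw [h4 n.succ (by omega) ?_, h4 k (by omega) ?_]
  · intro m hm
    rw [Polynomial.coeff_eq_zero_of_natDegree_lt (by omega), zero_mul]
  · intro m hm
    rw [completeHomog, if_neg (by omega), map_zero, mul_zero]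

/-- If all minors `S_l` vanish under `θ`, there is a nonzero vector orthogonal to any given vector
and to the columns of `θ(H)`. -/
theorem exists_orthogonal_of_map_Spoly_eq_zero {A : Type*} [CommRing A] [IsDomain A] {k : ℕ}
    {e : Fin (k + 1) → ℕ} {θ : MvPolynomial (Fin k) ℂ →+* A} (hθ : ∀ l, θ (Spoly k e l) = 0)
    (y : Fin (k + 1) → A) : ∃ L : Fin (k + 1) → A, L ≠ 0 ∧ y ⬝ᵥ L = 0 ∧
      ∀ b, (fun a => θ (Hmat k e a b)) ⬝ᵥ L = 0 := by
  have hdet : (Matrix.of (Fin.cons y fun b a => θ (Hmat k e a b) :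
      Fin (k + 1) → Fin (k + 1) → A)).det = 0 := by
    rw [Matrix.det_succ_row_zero]
    refine Finset.sum_eq_zero fun l _ => ?_
    have : (Matrix.submatrix (Matrix.of (Fin.cons y fun b a => θ (Hmat k e a b) :
        Fin (k + 1) → Fin (k + 1) → A)) Fin.succ l.succAbove).det = θ (Spoly k e l) := by
      rw [← Matrix.det_transpose, Spoly, RingHom.map_det]
      rfl
    rw [this, hθ, mul_zero]
  obtain ⟨L, hL0, hL⟩ := det_of_eq_zero_iff.1 hdet
  exact ⟨L, hL0, hL 0, fun b => hL b.succ⟩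

theorem coeff_completeHomogSeries_mul_dotProduct {A : Type*} [CommRing A] {k : ℕ}
    {e : Fin (k + 1) → ℕ} {θ : MvPolynomial (Fin k) ℂ →+* A} {L : Fin (k + 1) → A}
    (hL : ∀ b, (fun a => θ (Hmat k e a b)) ⬝ᵥ L = 0) (g : Polynomial A) (hg : g.natDegree < k) :
    (fun a => PowerSeries.coeff (e a) (completeHomogSeries θ * (g : PowerSeries A))) ⬝ᵥ L = 0 := by
  simp only [dotProduct, coeff_completeHomogSeries_mul θ g hg, Finset.sum_mul]
  rw [Finset.sum_comm]
  refine Finset.sum_eq_zero fun b _ => ?_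
  rw [← mul_zero (g.coeff (k - 1 - b)), ← hL b, dotProduct, Finset.mul_sum]
  refine Finset.sum_congr rfl fun a _ => ?_
  rw [mul_assoc]
  rfl

theorem natDegree_prod_one_sub_lt {A : Type*} [CommRing A] {ι : Type*} (s : Finset ι)
    (x : ι → A) : (∏ c ∈ s, (1 - Polynomial.C (x c) * Polynomial.X)).natDegree ≤ s.card := by
  refine (Polynomial.natDegree_prod_le _ _).trans ?_
  rw [Finset.card_eq_sum_ones]
  refine Finset.sum_le_sum fun c _ => ?_
  refine (Polynomial.natDegree_sub_le _ _).trans ?_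
  rw [Polynomial.natDegree_one, Nat.zero_max]
  exact (Polynomial.natDegree_C_mul_le _ _).trans Polynomial.natDegree_X_le

theorem completeHomogSeries_mul_prod {A : Type*} [CommRing A] {k : ℕ}
    (θ : MvPolynomial (Fin k) ℂ →+* A) (s : Finset (Fin k)) :
    completeHomogSeries θ *
      ((∏ c ∈ sᶜ, (1 - Polynomial.C (θ (X c)) * Polynomial.X) : Polynomial A) : PowerSeries A) =
      ∏ c ∈ s, PowerSeries.mk fun m => θ (X c) ^ m := by
  rw [completeHomogSeries_eq_prod, ← Finset.prod_mul_prod_compl s, mul_assoc,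
    ← Polynomial.coeToPowerSeries.ringHom_apply, map_prod, ← Finset.prod_mul_distrib,
    Finset.prod_eq_one (s := sᶜ), mul_one]
  intro c _
  simp [mk_pow_mul_one_sub]

theorem powRow_dotProduct_eq_zero {A : Type*} [CommRing A] {k : ℕ}
    {e : Fin (k + 1) → ℕ} {θ : MvPolynomial (Fin k) ℂ →+* A} {L : Fin (k + 1) → A}
    (hL : ∀ b, (fun a => θ (Hmat k e a b)) ⬝ᵥ L = 0) (b : Fin k) :
    powRow e (θ (X b)) ⬝ᵥ L = 0 := by
  have h := coeff_completeHomogSeries_mul_dotProduct hL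
    (∏ c ∈ {b}ᶜ, (1 - Polynomial.C (θ (X c)) * Polynomial.X)) (by
      refine (natDegree_prod_one_sub_lt _ _).trans_lt ?_
      have := b.pos
      rw [Finset.card_compl, Finset.card_singleton, Fintype.card_fin]
      omega)
  simp only [completeHomogSeries_mul_prod, Finset.prod_singleton, PowerSeries.coeff_mk] at h
  exact h

theorem derivRow_dotProduct_eq_zero {A : Type*} [CommRing A] {k : ℕ}
    {e : Fin (k + 1) → ℕ} {θ : MvPolynomial (Fin k) ℂ →+* A} {L : Fin (k + 1) → A}
    (hL : ∀ b, (fun a => θ (Hmat k e a b)) ⬝ᵥ L = 0) {b c : Fin k} (hbc : b ≠ c)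
    (h : θ (X b) = θ (X c)) : derivRow e (θ (X b)) ⬝ᵥ L = 0 := by
  have hk : 2 ≤ k := by
    have := b.isLt; have := c.isLt; have := Fin.val_ne_of_ne hbc; omega
  have h1 := coeff_completeHomogSeries_mul_dotProduct hL
    ((∏ c ∈ {b, c}ᶜ, (1 - Polynomial.C (θ (X c)) * Polynomial.X)) * Polynomial.X) (by
      refine Polynomial.natDegree_mul_le.trans_lt ?_
      have h2 := natDegree_prod_one_sub_lt ({b, c}ᶜ : Finset (Fin k)) fun c => θ (X c)
      have h3 := Polynomial.natDegree_X_le (R := A)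
      rw [Finset.card_compl, Finset.card_pair hbc, Fintype.card_fin] at h2
      omega)
  rw [Polynomial.coe_mul, ← mul_assoc, completeHomogSeries_mul_prod, Finset.prod_pair hbc, ← h,
    Polynomial.coe_X] at h1
  rw [← h1]
  congr 1
  funext a
  rw [derivRow]
  rcases e a with _ | n
  · simp
  · rw [PowerSeries.coeff_succ_mul_X, PowerSeries.coeff_mul, Finset.sum_congr rfl (g := fun _ =>
      θ (X b) ^ n)]
    · simp
    · intro p hp
      rw [PowerSeries.coeff_mk, PowerSeries.coeff_mk, ← pow_add, Finset.HasAntidiagonal.mem_antidiagonal.1 hp]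

theorem eval_eq_zero_of_dvd_X_sub_X {σ : Type*} {p : MvPolynomial σ ℂ} (hp : Prime p) {i j : σ}
    (hij : i ≠ j) (h : p ∣ X i - X j) (x : σ → ℂ) (hx : x i = x j) : eval x p = 0 := by
  obtain ⟨q, hq⟩ := h
  have hne : (X i - X j : MvPolynomial σ ℂ) ≠ 0 := sub_ne_zero.2 fun h => hij (X_injective h)
  have hq0 : q ≠ 0 := by rintro rfl; simp [hne] at hq
  have hpdeg : p.totalDegree ≠ 0 := by
    intro h0
    rw [totalDegree_eq_zero_iff_eq_C] at h0
    apply hp.not_isUnit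
    rw [h0]
    refine IsUnit.map C (isUnit_iff_ne_zero.2 fun h1 => hp.ne_zero ?_)
    rw [h0, h1, C_0]
  have hdeg : (X i - X j : MvPolynomial σ ℂ).totalDegree ≤ 1 := by
    refine (totalDegree_sub _ _).trans ?_
    rw [totalDegree_X, totalDegree_X, max_self]
  rw [hq, totalDegree_mul_of_isDomain hp.ne_zero hq0] at hdeg
  have hqC := totalDegree_eq_zero_iff_eq_C.1 (show q.totalDegree = 0 by omega)
  have h2 := congrArg (eval x) hq
  rw [map_sub, eval_X, eval_X, hx, sub_self, map_mul, hqC, eval_C] at h2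
  rcases mul_eq_zero.1 h2.symm with h3 | h3
  · exact h3
  · rw [h3, C_0] at hqC
    exact (hq0 hqC).elim

/-- The minors `S_0, …, S_k` have no common prime factor. -/
theorem exists_not_dvd_Spoly {k : ℕ} (hk : 2 ≤ k) {e : Fin (k + 1) → ℕ}
    (he : Function.Injective e) (he0 : e 0 = 0)
    (hgcd : Finset.gcd (Finset.Ioi (0 : Fin (k + 1))) e = 1)
    {p : MvPolynomial (Fin k) ℂ} (hp : Prime p) : ∃ l, ¬ p ∣ Spoly k e l := by
  by_contra! hS
  have hdvd : ∀ l, p ∣ (Matrix.of (Function.update (powRows e X) 0 (Pi.single l 1))).det := by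
    intro l
    set π := Ideal.Quotient.mk (Ideal.span {p}) with hπ
    have hπ0 : ∀ x, π x = 0 ↔ p ∣ x := fun x => by
      rw [hπ, Ideal.Quotient.eq_zero_iff_mem, Ideal.mem_span_singleton]
    have : (Ideal.span {p}).IsPrime := (Ideal.span_singleton_prime hp.ne_zero).2 hp
    obtain ⟨L, hL0, hy, hL⟩ := exists_orthogonal_of_map_Spoly_eq_zero (θ := π) (e := e)
      (fun l => (hπ0 _).2 (hS l)) fun a => π ((Pi.single l 1 : Fin (k + 1) → _) a)
    rw [← hπ0, map_det_of, det_of_eq_zero_iff]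
    refine ⟨L, hL0, fun c => ?_⟩
    induction c using Fin.cases with
    | zero => simpa using hy
    | succ c =>
      rw [← powRow_dotProduct_eq_zero hL c]
      congr 1
  obtain ⟨i, j, hij, hpij⟩ := exists_dvd_X_sub_X hk he he0 hgcd hp hdvd
  set t : Fin (k + 1) → ℝ := Function.update (fun c => (c : ℝ) + 1) i.succ ((j : ℝ) + 2) with ht
  have htj : t j.succ = (j : ℝ) + 2 := by
    rw [ht, Function.update_of_ne (by simpa using hij.symm)]
    simp; ring
  have hti : t i.succ = (j : ℝ) + 2 := by rw [ht, Function.update_self]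
  set θ := eval (fun b : Fin k => ((t b.succ : ℝ) : ℂ)) with hθ
  have hθX : ∀ b, θ (X b) = t b.succ := fun b => eval_X _
  have hθp : θ p = 0 := eval_eq_zero_of_dvd_X_sub_X hp hij hpij _ (by rw [hti, htj])
  obtain ⟨L, hL0, hy, hL⟩ := exists_orthogonal_of_map_Spoly_eq_zero (θ := θ) (e := e)
    (fun l => by
      obtain ⟨q, hq⟩ := hS l
      rw [hq, map_mul, hθp, zero_mul]) (powRow e ((t 0 : ℝ) : ℂ))
  refine det_confluent_ne_zero he (RingHom.id ℂ) (fun c => (t c : ℂ)) t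
    (fun c => decide (c = i.succ)) (fun _ => rfl) ?_ ?_ ?_ (det_of_eq_zero_iff.2 ⟨L, hL0, ?_⟩)
  · intro c
    by_cases hc : c = i.succ
    · rw [hc, hti]; positivity
    · rw [ht, Function.update_of_ne hc]; positivity
  · intro c d hcd
    simp only [Prod.mk.injEq, decide_eq_decide] at hcd
    by_cases hc : c = i.succ
    · rw [hc, hcd.2.1 hc]
    · have hd : d ≠ i.succ := fun h => hc (hcd.2.2 h)
      rw [ht, Function.update_of_ne hc, Function.update_of_ne hd] at hcd
      simpa [Fin.ext_iff] using hcd.1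
  · intro c hc
    rw [decide_eq_true_eq] at hc
    refine ⟨j.succ, by rw [hc, hti, htj], ?_⟩
    simpa using hij.symm
  · intro c
    by_cases hc : c = i.succ
    · subst hc
      rw [if_pos (by simp)]
      have := derivRow_dotProduct_eq_zero hL hij (by rw [hθX, hθX, hti, htj])
      rwa [hθX] at this
    · rw [if_neg (by simpa using hc)]
      induction c using Fin.cases with
      | zero => exact hy
      | succ c =>
        have := powRow_dotProduct_eq_zero hL c
        rwa [hθX] at this

/-- If `a` divides all `S l * w` and no prime divides all `S l`, then `a` divides `w`. -/
theorem dvd_of_forall_dvd_mul {A ι : Type*} [CommRing A] [IsDomain A]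
    [UniqueFactorizationMonoid A] {S : ι → A} (hS : ∀ p, Prime p → ∃ l, ¬ p ∣ S l)
    {a : A} (ha : a ≠ 0) {w : A} (h : ∀ l, a ∣ S l * w) : a ∣ w := by
  induction a using UniqueFactorizationMonoid.induction_on_prime generalizing w with
  | h₁ => exact (ha rfl).elim
  | h₂ x hx => exact hx.dvd
  | h₃ b p hb hp ih =>
    obtain ⟨l, hl⟩ := hS p hp
    obtain ⟨w, rfl⟩ := (hp.dvd_or_dvd ((dvd_mul_right p b).trans (h l))).resolve_left hl
    refine mul_dvd_mul_left p (ih hb fun m => ?_)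
    have := h m
    rwa [mul_left_comm, mul_dvd_mul_iff_left hp.ne_zero] at this

/-- The maximal minor of a `(k + 1) × k` matrix obtained by deleting the `l`-th row, with sign. -/
def signedMinor {A : Type*} [CommRing A] {k : ℕ} (H : Matrix (Fin (k + 1)) (Fin k) A)
    (l : Fin (k + 1)) : A :=
  (-1) ^ (l : ℕ) * (H.submatrix l.succAbove id).det

theorem det_cons_column {A : Type*} [CommRing A] {k : ℕ} (H : Matrix (Fin (k + 1)) (Fin k) A)
    (v : Fin (k + 1) → A) :
    (Matrix.of fun a => (Fin.cons (v a) (H a) : Fin (k + 1) → A)).det =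
      ∑ l, signedMinor H l * v l := by
  rw [Matrix.det_succ_column_zero]
  refine Finset.sum_congr rfl fun l _ => ?_
  rw [signedMinor, mul_right_comm]
  rfl

theorem sum_signedMinor_mul {A : Type*} [CommRing A] {k : ℕ}
    (H : Matrix (Fin (k + 1)) (Fin k) A) (b : Fin k) : ∑ l, signedMinor H l * H l b = 0 := by
  rw [← det_cons_column]
  exact Matrix.det_zero_of_column_eq (Fin.succ_ne_zero b).symm fun a => rfl

theorem eq_zero_of_mulVec_eq_zero_of_signedMinor_ne_zero {A : Type*} [CommRing A] [IsDomain A]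
    {k : ℕ} {H : Matrix (Fin (k + 1)) (Fin k) A} {l : Fin (k + 1)} (hl : signedMinor H l ≠ 0)
    {w : Fin k → A} (hw : H.mulVec w = 0) : w = 0 :=
  Matrix.eq_zero_of_mulVec_eq_zero (M := H.submatrix l.succAbove id)
    (right_ne_zero_of_mul hl) (funext fun a => congrFun hw (l.succAbove a))

/-- **Hilbert–Burch**: the syzygies of the maximal minors of a `(k + 1) × k` matrix without common
prime factor are generated by the columns. -/
theorem exists_mulVec_eq_of_sum_signedMinor_mul_eq_zero {A : Type*} [CommRing A] [IsDomain A]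
    [UniqueFactorizationMonoid A] {k : ℕ} {H : Matrix (Fin (k + 1)) (Fin k) A}
    (hne : ∃ l, signedMinor H l ≠ 0) (hH : ∀ p, Prime p → ∃ l, ¬ p ∣ signedMinor H l)
    {v : Fin (k + 1) → A} (hv : ∑ l, signedMinor H l * v l = 0) : ∃ w, H.mulVec w = v := by
  rw [← det_cons_column, ← Matrix.exists_mulVec_eq_zero_iff] at hv
  obtain ⟨u, hu0, hu⟩ := hv
  have hu' : ∀ a, v a * u 0 + (H.mulVec (Fin.tail u)) a = 0 := by
    intro a
    have := congrFun hu a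
    rw [Matrix.mulVec, dotProduct, Fin.sum_univ_succ] at this
    exact this
  obtain ⟨l, hl⟩ := hne
  have hu00 : u 0 ≠ 0 := by
    intro h0
    apply hu0
    have h1 : Fin.tail u = 0 := eq_zero_of_mulVec_eq_zero_of_signedMinor_ne_zero hl
      (funext fun a => by simpa [h0] using hu' a)
    funext a
    induction a using Fin.cases with
    | zero => exact h0
    | succ b => exact congrFun h1 b
  have hdvd : ∀ b, u 0 ∣ Fin.tail u b := by
    intro b
    refine dvd_of_forall_dvd_mul hH hu00 fun l => ?_
    rw [signedMinor, mul_assoc]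
    apply Dvd.dvd.mul_left
    set M := H.submatrix l.succAbove id with hM
    have h1 : M.mulVec (Fin.tail u) = -(u 0) • fun a => v (l.succAbove a) := by
      funext a
      have := hu' (l.succAbove a)
      change (H.mulVec (Fin.tail u)) (l.succAbove a) = -(u 0) * v (l.succAbove a)
      linear_combination this
    have h2 := congrArg (M.adjugate.mulVec) h1
    rw [Matrix.mulVec_mulVec, Matrix.adjugate_mul, Matrix.smul_mulVec, Matrix.one_mulVec,
      Matrix.mulVec_smul] at h2
    have h3 := congrFun h2 b
    simp only [Pi.smul_apply, smul_eq_mul, neg_mul] at h3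
    rw [h3]
    exact (dvd_mul_right _ _).neg_right
  choose w hw using hdvd
  refine ⟨-w, funext fun a => mul_left_cancel₀ hu00 ?_⟩
  have h1 : Fin.tail u = u 0 • w := funext hw
  have := hu' a
  rw [h1, Matrix.mulVec_smul, Pi.smul_apply, smul_eq_mul] at this
  rw [Matrix.mulVec_neg, Pi.neg_apply]
  linear_combination -this

/-- The graded components of an ideal of maximal minors with a Hilbert–Burch resolution. -/
theorem finrank_inf_span_signedMinor_add_sum {F A : Type*} [Field F] [CommRing A] [IsDomain A]
    [UniqueFactorizationMonoid A] [Algebra F A] (𝒜 : ℤ → Submodule F A) [GradedAlgebra 𝒜]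
    [∀ d, FiniteDimensional F (𝒜 d)] {k : ℕ} {H : Matrix (Fin (k + 1)) (Fin k) A}
    (hne : ∃ l, signedMinor H l ≠ 0) (hH : ∀ p, Prime p → ∃ l, ¬ p ∣ signedMinor H l)
    {f : Fin k → ℤ} {g : Fin (k + 1) → ℤ} (hg : ∀ l, signedMinor H l ∈ 𝒜 (g l))
    (hf : ∀ l b, H l b ∈ 𝒜 (f b - g l)) (d : ℤ) :
    Module.finrank F (𝒜 d ⊓ (Ideal.span (Set.range (signedMinor H))).restrictScalars F :
        Submodule F A) + ∑ b, Module.finrank F (𝒜 (d - f b)) =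
      ∑ l, Module.finrank F (𝒜 (d - g l)) := by
  let φ : (∀ l, 𝒜 (d - g l)) →ₗ[F] A :=
    ∑ l, LinearMap.mulLeft F (signedMinor H l) ∘ₗ (𝒜 (d - g l)).subtype ∘ₗ LinearMap.proj l
  have hφ : ∀ r, φ r = ∑ l, signedMinor H l * (r l : A) := fun r => by simp [φ]
  have hmem : ∀ (w : ∀ b, 𝒜 (d - f b)) (l : Fin (k + 1)),
      ∑ b, H l b * (w b : A) ∈ 𝒜 (d - g l) := by
    intro w l
    refine Submodule.sum_mem _ fun b _ => ?_
    have := SetLike.GradedMul.mul_mem (hf l b) (w b).2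
    rwa [show f b - g l + (d - f b) = d - g l by ring] at this
  let ψ : (∀ b, 𝒜 (d - f b)) →ₗ[F] ∀ l, 𝒜 (d - g l) := LinearMap.pi fun l =>
    LinearMap.codRestrict (𝒜 (d - g l))
      (∑ b, LinearMap.mulLeft F (H l b) ∘ₗ (𝒜 (d - f b)).subtype ∘ₗ LinearMap.proj b)
      fun w => by simpa using hmem w l
  have hψ : ∀ w l, ((ψ w l : 𝒜 (d - g l)) : A) = ∑ b, H l b * (w b : A) := fun w l => by simp [ψ]
  have hcomp : ∀ (a x : A) (m n : ℤ), a ∈ 𝒜 m →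
      (DirectSum.decompose 𝒜 (a * x) n : A) = a * (DirectSum.decompose 𝒜 x (n - m) : A) := by
    intro a x m n ha
    rw [← DirectSum.coe_decompose_mul_add_of_left_mem 𝒜 ha, add_sub_cancel]
  have hsum : ∀ {ι : Type} (s : Finset ι) (x : ι → A) (n : ℤ),
      (DirectSum.decompose 𝒜 (∑ c ∈ s, x c) n : A) = ∑ c ∈ s, (DirectSum.decompose 𝒜 (x c) n : A) := by
    intro ι s x n
    rw [DirectSum.decompose_sum, DFinsupp.finsetSum_apply, AddSubmonoidClass.coe_finsetSum]
  have hrange : LinearMap.range φ =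
      𝒜 d ⊓ (Ideal.span (Set.range (signedMinor H))).restrictScalars F := by
    ext x
    simp only [LinearMap.mem_range, Submodule.mem_inf, Submodule.restrictScalars_mem]
    constructor
    · rintro ⟨r, rfl⟩
      rw [hφ]
      constructor
      · refine Submodule.sum_mem _ fun l _ => ?_
        have := SetLike.GradedMul.mul_mem (hg l) (r l).2
        rwa [add_sub_cancel] at this
      · exact Ideal.sum_mem _ fun l _ =>
          Ideal.mul_mem_right _ _ (Ideal.subset_span (Set.mem_range_self l))
    · rintro ⟨hx, hxI⟩
      obtain ⟨c, hc⟩ := Ideal.mem_span_range_iff_exists_fun.1 hxI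
      refine ⟨fun l => DirectSum.decompose 𝒜 (c l) (d - g l), ?_⟩
      rw [hφ, ← DirectSum.decompose_of_mem_same 𝒜 hx, ← hc, hsum]
      refine Finset.sum_congr rfl fun l _ => ?_
      rw [mul_comm (c l), hcomp _ _ _ _ (hg l)]
  have hker : LinearMap.ker φ = LinearMap.range ψ := by
    ext r
    rw [LinearMap.mem_ker, hφ, LinearMap.mem_range]
    constructor
    · intro hr
      obtain ⟨w, hw⟩ := exists_mulVec_eq_of_sum_signedMinor_mul_eq_zero hne hH hr
      refine ⟨fun b => DirectSum.decompose 𝒜 (w b) (d - f b), funext fun l => Subtype.ext ?_⟩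
      rw [hψ, ← DirectSum.decompose_of_mem_same 𝒜 (r l).2, ← congrFun hw l, Matrix.mulVec,
        dotProduct, hsum]
      refine Finset.sum_congr rfl fun b _ => ?_
      rw [hcomp _ _ _ _ (hf l b), sub_sub_sub_cancel_right]
    · rintro ⟨w, rfl⟩
      simp only [hψ, Finset.mul_sum, ← mul_assoc]
      rw [Finset.sum_comm]
      simp only [← Finset.sum_mul, sum_signedMinor_mul, zero_mul, Finset.sum_const_zero]
  have hinj : Function.Injective ψ := by
    rw [← LinearMap.ker_eq_bot, LinearMap.ker_eq_bot']
    intro w hw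
    obtain ⟨l, hl⟩ := hne
    have := eq_zero_of_mulVec_eq_zero_of_signedMinor_ne_zero hl (w := fun b => (w b : A))
      (funext fun l => by
        have := hψ w l
        rw [hw] at this
        exact this.symm)
    exact funext fun b => Subtype.ext (congrFun this b)
  have h1 := LinearMap.finrank_range_add_finrank_ker φ
  rw [hrange, hker, LinearMap.finrank_range_of_inj hinj, Module.finrank_pi_fintype,
    Module.finrank_pi_fintype] at h1
  exact h1

theorem finrank_map_mkₐ_add_finrank_inf {F A : Type*} [Field F] [CommRing A] [Algebra F A]
    (I : Ideal A) (V : Submodule F A) [FiniteDimensional F V] :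
    Module.finrank F (V.map (Ideal.Quotient.mkₐ F I).toLinearMap) +
      Module.finrank F (V ⊓ I.restrictScalars F : Submodule F A) = Module.finrank F V := by
  have h := LinearMap.finrank_range_add_finrank_ker
    ((Ideal.Quotient.mkₐ F I).toLinearMap ∘ₗ V.subtype)
  rw [LinearMap.range_comp, Submodule.range_subtype] at h
  have hker : V ⊓ I.restrictScalars F = Submodule.map V.subtype
      (LinearMap.ker ((Ideal.Quotient.mkₐ F I).toLinearMap ∘ₗ V.subtype)) := by
    ext x
    simp [Ideal.Quotient.eq_zero_iff_mem, and_comm]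
  rw [← h, hker, Submodule.finrank_map_subtype_eq V]

/-- The homogeneous polynomials of degree `d ∈ ℤ`. -/
noncomputable abbrev gradedPart (k : ℕ) (d : ℤ) : Submodule ℂ (MvPolynomial (Fin k) ℂ) :=
  weightedHomogeneousSubmodule ℂ (fun _ => (1 : ℤ)) d

theorem weight_one_eq_sum {k : ℕ} (m : Fin k →₀ ℕ) :
    Finsupp.weight (fun _ => (1 : ℤ)) m = ((∑ b, m b : ℕ) : ℤ) := by
  rw [Finsupp.weight_eq_sum]
  simp

theorem homogeneousSubmodule_eq_gradedPart (k d : ℕ) :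
    homogeneousSubmodule (Fin k) ℂ d = gradedPart k d := by
  ext p
  rw [mem_homogeneousSubmodule, mem_weightedHomogeneousSubmodule]
  refine forall_congr' fun m => imp_congr_right fun _ => ?_
  rw [weight_one_eq_sum, Nat.cast_inj, Finsupp.weight_eq_sum]
  simp

/-- The exponents of the monomials of degree `d ∈ ℤ`. -/
noncomputable def degreeExponents (k : ℕ) (d : ℤ) : Finset (Fin k →₀ ℕ) :=
  if 0 ≤ d then (Finset.Nat.antidiagonalTuple k d.toNat).map Finsupp.equivFunOnFinite.symm.toEmbedding
  else ∅

theorem mem_degreeExponents {k : ℕ} {d : ℤ} {m : Fin k →₀ ℕ} :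
    m ∈ degreeExponents k d ↔ Finsupp.weight (fun _ => (1 : ℤ)) m = d := by
  rw [weight_one_eq_sum, degreeExponents]
  split_ifs with h
  · rw [Finset.mem_map_equiv, Finset.Nat.mem_antidiagonalTuple, Equiv.symm_symm]
    simp only [Finsupp.equivFunOnFinite_apply]
    omega
  · simp only [Finset.notMem_empty, false_iff]
    omega

theorem gradedPart_eq_restrictSupport (k : ℕ) (d : ℤ) :
    gradedPart k d = restrictSupport ℂ (degreeExponents k d : Set (Fin k →₀ ℕ)) := by
  rw [gradedPart, weightedHomogeneousSubmodule_eq_finsupp_supported, restrictSupport]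
  congr 1
  ext m
  exact mem_degreeExponents.symm

instance (k : ℕ) (d : ℤ) : FiniteDimensional ℂ (gradedPart k d) := by
  rw [gradedPart_eq_restrictSupport]
  exact Module.Finite.of_basis (basisRestrictSupport ℂ _)

theorem finrank_gradedPart (k : ℕ) (d : ℤ) :
    Module.finrank ℂ (gradedPart k d) = (degreeExponents k d).card := by
  rw [gradedPart_eq_restrictSupport,
    Module.finrank_eq_nat_card_basis (basisRestrictSupport ℂ _)]
  simp

theorem finrank_gradedPart_sub (k n e : ℕ) :
    (Module.finrank ℂ (gradedPart k ((n : ℤ) - e)) : ℤ) = PowerSeries.coeff n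
      ((∏ _c : Fin k, PowerSeries.mk fun m => (1 : ℤ) ^ m) * PowerSeries.X ^ e) := by
  rw [finrank_gradedPart, PowerSeries.coeff_mul_X_pow', degreeExponents]
  by_cases h : e ≤ n
  · rw [if_pos h, if_pos (by omega), coeff_prod_mk_pow fun _ : Fin k => (1 : ℤ), Finset.card_map,
      show ((n : ℤ) - e).toNat = n - e by omega]
    simp
  · rw [if_neg h, if_neg (by omega)]
    simp

theorem completeHomog_mem_gradedPart (k : ℕ) (d : ℤ) : completeHomog k d ∈ gradedPart k d := by
  rw [completeHomog]
  split_ifs with h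
  · refine Submodule.sum_mem _ fun μ hμ => ?_
    rw [mem_weightedHomogeneousSubmodule]
    have := IsWeightedHomogeneous.prod (w := fun _ => (1 : ℤ)) Finset.univ
      (fun b : Fin k => (X b : MvPolynomial (Fin k) ℂ) ^ μ b) (fun b => μ b • 1)
      fun b _ => (isWeightedHomogeneous_X ℂ _ b).pow _
    convert this
    rw [Finset.Nat.mem_antidiagonalTuple] at hμ
    simp only [nsmul_eq_mul, mul_one, ← Nat.cast_sum, hμ]
    omega
  · exact Submodule.zero_mem _

theorem sum_fin_eq_choose_two (k : ℕ) : ∑ a : Fin k, (a : ℕ) = k.choose 2 := by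
  rw [Fin.sum_univ_eq_sum_range fun a => a, Finset.sum_range_id, Nat.choose_two_right]

theorem sum_fin_rev_eq_choose_two (k : ℕ) :
    ∑ a : Fin k, ((k : ℤ) - 1 - (a : ℕ)) = k.choose 2 := by
  rw [← sum_fin_eq_choose_two, ← Equiv.sum_comp Fin.revPerm, Nat.cast_sum]
  refine Finset.sum_congr rfl fun a _ => ?_
  simp

theorem signedMinor_Hmat (k : ℕ) (e : Fin (k + 1) → ℕ) (l : Fin (k + 1)) :
    signedMinor (Hmat k e) l = (-1) ^ (l : ℕ) * Spoly k e l := rfl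

theorem dvd_signedMinor_Hmat {k : ℕ} {e : Fin (k + 1) → ℕ} {l : Fin (k + 1)}
    {p : MvPolynomial (Fin k) ℂ} : p ∣ signedMinor (Hmat k e) l ↔ p ∣ Spoly k e l := by
  rw [signedMinor_Hmat]
  exact (isUnit_one.neg.pow _).dvd_mul_left

theorem vandermondeIdealA_eq_span_signedMinor (k : ℕ) (e : Fin (k + 1) → ℕ) :
    vandermondeIdealA k e = Ideal.span (Set.range (signedMinor (Hmat k e))) := by
  rw [vandermondeIdealA]
  refine le_antisymm (Ideal.span_le.2 ?_) (Ideal.span_le.2 ?_)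
  · rintro _ ⟨l, rfl⟩
    exact Ideal.mem_of_dvd _ (dvd_signedMinor_Hmat.1 dvd_rfl)
      (Ideal.subset_span (Set.mem_range_self l))
  · rintro _ ⟨l, rfl⟩
    exact Ideal.mem_of_dvd _ (dvd_signedMinor_Hmat.2 dvd_rfl)
      (Ideal.subset_span (Set.mem_range_self l))

theorem signedMinor_Hmat_mem_gradedPart {k : ℕ} (e : Fin (k + 1) → ℕ) (l : Fin (k + 1)) :
    signedMinor (Hmat k e) l ∈ gradedPart k (((∑ a, e a : ℕ) : ℤ) - e l - k.choose 2) := by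
  have hS : Spoly k e l ∈ gradedPart k (((∑ a, e a : ℕ) : ℤ) - e l - k.choose 2) := by
    rw [Spoly, Matrix.det_apply]
    refine Submodule.sum_mem _ fun τ _ => ?_
    rw [Units.smul_def]
    refine zsmul_mem ?_ _
    rw [mem_weightedHomogeneousSubmodule]
    have := IsWeightedHomogeneous.prod (w := fun _ => (1 : ℤ)) Finset.univ
      (fun b : Fin k => Hmat k e (l.succAbove (τ b)) b)
      (fun b => (e (l.succAbove (τ b)) : ℤ) - ((k : ℤ) - 1 - (b : ℕ)))
      fun b _ => completeHomog_mem_gradedPart k _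
    convert this using 1
    · rfl
    rw [Finset.sum_sub_distrib, sum_fin_rev_eq_choose_two,
      Equiv.sum_comp τ fun a => (e (l.succAbove a) : ℤ), Fin.sum_univ_succAbove _ l]
    push_cast
    ring
  rw [signedMinor_Hmat]
  rcases neg_one_pow_eq_or (MvPolynomial (Fin k) ℂ) (l : ℕ) with h | h
  · rwa [h, one_mul]
  · rw [h, neg_one_mul]
    exact Submodule.neg_mem _ hS

theorem exists_signedMinor_Hmat_ne_zero {k : ℕ} (hk : 2 ≤ k) {e : Fin (k + 1) → ℕ}
    (he : Function.Injective e) (he0 : e 0 = 0)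
    (hgcd : Finset.gcd (Finset.Ioi (0 : Fin (k + 1))) e = 1) :
    ∃ l, signedMinor (Hmat k e) l ≠ 0 := by
  obtain ⟨l, hl⟩ := exists_not_dvd_Spoly hk he he0 hgcd (X_prime (R := ℂ) (i := (⟨0, by omega⟩ : Fin k)))
  exact ⟨l, fun h => hl (dvd_signedMinor_Hmat.1 (h ▸ dvd_zero _))⟩

theorem le_apply_of_strictMono_fin {n : ℕ} {f : Fin n → ℕ} (hf : StrictMono f) (a : Fin n) :
    (a : ℕ) ≤ f a := by
  obtain ⟨a, ha⟩ := a
  induction a with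
  | zero => exact Nat.zero_le _
  | succ a ih =>
    exact (ih (by omega)).trans_lt (hf (Fin.mk_lt_mk.2 a.lt_succ_self))

theorem add_choose_two_le_sum {k : ℕ} {e : Fin (k + 1) → ℕ} (he : StrictMono e)
    (l : Fin (k + 1)) : e l + k.choose 2 ≤ ∑ a, e a := by
  rw [Fin.sum_univ_succAbove _ l, ← sum_fin_eq_choose_two]
  gcongr with a
  exact le_apply_of_strictMono_fin (he.comp (Fin.strictMono_succAbove l)) a

/-- The Hilbert function of `R / I_I^A`. -/
theorem finrank_quotient_vandermondeIdealA {k : ℕ} (hk : 2 ≤ k) {e : Fin (k + 1) → ℕ}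
    (he : Function.Injective e) (he0 : e 0 = 0)
    (hgcd : Finset.gcd (Finset.Ioi (0 : Fin (k + 1))) e = 1) (d : ℕ) :
    (Module.finrank ℂ (Submodule.map (Ideal.Quotient.mkₐ ℂ (vandermondeIdealA k e)).toLinearMap
      (homogeneousSubmodule (Fin k) ℂ d)) : ℤ) =
      Module.finrank ℂ (gradedPart k d)
      - ∑ l, (Module.finrank ℂ (gradedPart k
          (d - (((∑ a, e a : ℕ) : ℤ) - e l - k.choose 2))) : ℤ)
      + ∑ b : Fin k, (Module.finrank ℂ (gradedPart k
          (d - (((∑ a, e a : ℕ) : ℤ) - ((k : ℤ) - 1 - (b : ℕ)) - k.choose 2))) : ℤ) := by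
  let : GradedAlgebra (gradedPart k) := weightedGradedAlgebra ℂ _
  have h1 := finrank_inf_span_signedMinor_add_sum (F := ℂ) (gradedPart k)
    (exists_signedMinor_Hmat_ne_zero hk he he0 hgcd)
    (fun p hp => (exists_not_dvd_Spoly hk he he0 hgcd hp).imp fun l hl h =>
      hl (dvd_signedMinor_Hmat.1 h))
    (g := fun l => ((∑ a, e a : ℕ) : ℤ) - e l - k.choose 2)
    (f := fun b => ((∑ a, e a : ℕ) : ℤ) - ((k : ℤ) - 1 - (b : ℕ)) - k.choose 2)
    (signedMinor_Hmat_mem_gradedPart e)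
    (fun l b => by
      have := completeHomog_mem_gradedPart k ((e l : ℤ) - ((k : ℤ) - 1 - (b : ℕ)))
      rwa [show ((∑ a, e a : ℕ) : ℤ) - ((k : ℤ) - 1 - (b : ℕ)) - k.choose 2 -
        (((∑ a, e a : ℕ) : ℤ) - e l - k.choose 2) = (e l : ℤ) - ((k : ℤ) - 1 - (b : ℕ)) by ring]) d
  rw [← vandermondeIdealA_eq_span_signedMinor] at h1
  have h2 := finrank_map_mkₐ_add_finrank_inf (vandermondeIdealA k e) (gradedPart k d)
  rw [homogeneousSubmodule_eq_gradedPart]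
  zify at h1 h2
  linear_combination h2 - h1

/-- Theorem `th:k*k+1`(iii): for `I = (0 = i₀ < i₁ < ⋯ < i_k)` with `gcd(i₁,…,i_k) = 1`
and `HF(d) = dim_ℂ (R/I_I^A)_d` the Hilbert function of the graded quotient,
`(1-t)^k · ∑_{d ≥ 0} HF(d) t^d = 1 - ∑_{j=1}^k t^{N - i_j - C(k,2)} +
∑_{j=1}^{k-1} t^{N - j - C(k,2)}` in `ℤ⟦t⟧`, where `N = i₁ + ⋯ + i_k`. -/
theorem hilbert_series_vandermonde_k_kplus1 (k : ℕ) (hk : 2 ≤ k) (i : Fin (k + 1) → ℕ)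
    (hi0 : i 0 = 0) (hmono : StrictMono i)
    (hgcd : Finset.gcd (Finset.Ioi (0 : Fin (k + 1))) i = 1) :
    let N : ℕ := ∑ j ∈ Finset.Ioi (0 : Fin (k + 1)), i j
    let HF : ℕ → ℕ := fun d =>
      Module.finrank ℂ (Submodule.map (Ideal.Quotient.mkₐ ℂ (vandermondeIdealA k i)).toLinearMap
        (homogeneousSubmodule (Fin k) ℂ d))
    (1 - PowerSeries.X) ^ k * PowerSeries.mk (fun d => (HF d : ℤ)) =
      1 - ∑ j ∈ Finset.Ioi (0 : Fin (k + 1)), (PowerSeries.X : PowerSeries ℤ) ^ (N - i j - k.choose 2)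
        + ∑ j ∈ Finset.Icc 1 (k - 1), (PowerSeries.X : PowerSeries ℤ) ^ (N - j - k.choose 2) := by
  intro N HF
  have hN : ∑ a, i a = N := by
    rw [Fin.sum_univ_succ, hi0, zero_add]
    simp only [N]
    rw [Fin.Ioi_zero_eq_map, Finset.sum_map]
    rfl
  have hle : ∀ l, i l + k.choose 2 ≤ N := fun l => hN ▸ add_choose_two_le_sum hmono l
  have hle' : ∀ m ≤ k, m + k.choose 2 ≤ N := fun m hm => by
    have h1 := le_apply_of_strictMono_fin hmono (Fin.last k)
    have h2 := hle (Fin.last k)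
    rw [Fin.val_last] at h1
    omega
  set Q : PowerSeries ℤ := ∏ _c : Fin k, PowerSeries.mk fun m => (1 : ℤ) ^ m with hQ
  have hQ1 : (1 - PowerSeries.X) ^ k * Q = 1 := by
    have h1 : (1 - PowerSeries.X : PowerSeries ℤ) ^ k = ∏ _c : Fin k, (1 - PowerSeries.X) := by simp
    rw [hQ, h1, ← Finset.prod_mul_distrib, Finset.prod_eq_one]
    intro c _
    have := mk_pow_mul_one_sub (1 : ℤ)
    rwa [map_one, one_mul, mul_comm] at this
  have hHF : PowerSeries.mk (fun d => (HF d : ℤ)) = Q * (1 -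
      ∑ l, (PowerSeries.X : PowerSeries ℤ) ^ (N - i l - k.choose 2) +
      ∑ b : Fin k, PowerSeries.X ^ (N - (k - 1 - b) - k.choose 2)) := by
    ext d
    rw [PowerSeries.coeff_mk, mul_add, mul_sub, Finset.mul_sum, Finset.mul_sum, map_add, map_sub,
      map_sum, map_sum, finrank_quotient_vandermondeIdealA hk hmono.injective hi0 hgcd d]
    congr 1
    · congr 1
      · have := finrank_gradedPart_sub k d 0
        rwa [pow_zero, Nat.cast_zero, sub_zero] at this
      · refine Finset.sum_congr rfl fun l _ => ?_
        have := hle l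
        rw [← finrank_gradedPart_sub, hN, show (N : ℤ) - i l - k.choose 2 =
          ((N - i l - k.choose 2 : ℕ) : ℤ) by omega]
    · refine Finset.sum_congr rfl fun b _ => ?_
      have := hle' (k - 1 - b) (by omega)
      have := b.isLt
      rw [← finrank_gradedPart_sub, hN, show (N : ℤ) - ((k : ℤ) - 1 - (b : ℕ)) - k.choose 2 =
        ((N - (k - 1 - b) - k.choose 2 : ℕ) : ℤ) by omega]
  rw [hHF, ← mul_assoc, hQ1, one_mul, Fin.sum_univ_succ, hi0]
  have h1 : ∑ j ∈ Finset.Ioi (0 : Fin (k + 1)),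
      (PowerSeries.X : PowerSeries ℤ) ^ (N - i j - k.choose 2) =
      ∑ j : Fin k, PowerSeries.X ^ (N - i j.succ - k.choose 2) := by
    rw [Fin.Ioi_zero_eq_map, Finset.sum_map]
    rfl
  have h2 : ∑ b : Fin k, (PowerSeries.X : PowerSeries ℤ) ^ (N - (k - 1 - b) - k.choose 2) =
      PowerSeries.X ^ (N - 0 - k.choose 2) +
      ∑ j ∈ Finset.Icc 1 (k - 1), PowerSeries.X ^ (N - j - k.choose 2) := by
    rw [Fin.sum_univ_eq_sum_range fun b =>
      (PowerSeries.X : PowerSeries ℤ) ^ (N - (k - 1 - b) - k.choose 2),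
      Finset.sum_range_reflect fun j => (PowerSeries.X : PowerSeries ℤ) ^ (N - j - k.choose 2),
      Finset.range_eq_Ico, Finset.sum_eq_sum_Ico_succ_bot (by omega)]
    congr 2
  rw [h1, h2]
  ring
end

section
/- Let k ≥ 2 and let 0 = i_0 < i_1 < ⋯ < i_k be integers. Then S_0 lies in the ideal of R generated by S_1, …, S_k; consequently the ideal I_I^A is generated by the k elements S_1, …, S_k. -/
open MvPolynomial

theorem completeHomog_zero (k : ℕ) : completeHomog k 0 = 1 := by
  simp [completeHomog, Finset.Nat.antidiagonalTuple_zero_right]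

/-- The maximal minors of a matrix with one more row than columns satisfy a linear relation
with the entries of any column as coefficients. -/
theorem sum_neg_one_pow_mul_det_succAbove_eq_zero {R : Type*} [CommRing R] {k : ℕ}
    (H : Matrix (Fin (k + 1)) (Fin k) R) (c : Fin k) :
    ∑ l : Fin (k + 1), (-1) ^ (l : ℕ) * H l c *
      Matrix.det (Matrix.of fun a b : Fin k => H (l.succAbove a) b) = 0 := by
  let M : Matrix (Fin (k + 1)) (Fin (k + 1)) R :=
    Matrix.of fun a => Fin.cons (H a c) (H a)
  have hM : M.det = 0 :=
    Matrix.det_zero_of_column_eq (Fin.succ_ne_zero c).symm fun a => by simp [M]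
  rw [Matrix.det_succ_column_zero] at hM
  exact hM

/-- Theorem `th:k*k+1`(v), first part: for `0 = i₀ < i₁ < ⋯ < i_k`, the Schur polynomial
`S₀` lies in the ideal generated by `S₁, …, S_k`; consequently `I_I^A` is generated by
the `k` elements `S₁, …, S_k`. -/
theorem S0_mem_span_of_rest (k : ℕ) (hk : 2 ≤ k) (i : Fin (k + 1) → ℕ)
    (hi0 : i 0 = 0) (hmono : StrictMono i) :
    Spoly k i 0 ∈ Ideal.span (Set.range fun j : Fin k => Spoly k i j.succ) ∧
      vandermondeIdealA k i = Ideal.span (Set.range fun j : Fin k => Spoly k i j.succ) := by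
  have hS : Spoly k i 0 ∈ Ideal.span (Set.range fun j : Fin k => Spoly k i j.succ) := by
    have hk0 : k - 1 < k := by omega
    have hrel := sum_neg_one_pow_mul_det_succAbove_eq_zero (Hmat k i) ⟨k - 1, hk0⟩
    have h00 : Hmat k i 0 ⟨k - 1, hk0⟩ = 1 := by
      have hd : ((i 0 : ℕ) : ℤ) - ((k : ℤ) - 1 - ((k - 1 : ℕ) : ℤ)) = 0 := by
        rw [hi0]; omega
      simp only [Hmat, Matrix.of_apply]
      rw [hd, completeHomog_zero]
    rw [Fin.sum_univ_succ, h00, Fin.val_zero, pow_zero, one_mul, one_mul] at hrel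
    change Spoly k i 0 + _ = 0 at hrel
    rw [eq_neg_of_add_eq_zero_left hrel]
    refine neg_mem (sum_mem fun j _ => Ideal.mul_mem_left _ _ ?_)
    exact Ideal.subset_span ⟨j, rfl⟩
  refine ⟨hS, le_antisymm (Ideal.span_le.2 ?_) (Ideal.span_mono ?_)⟩
  · rintro _ ⟨l, rfl⟩
    refine Fin.cases hS (fun j => ?_) l
    exact Ideal.subset_span ⟨j, rfl⟩
  · rintro _ ⟨j, rfl⟩
    exact ⟨j.succ, rfl⟩
end
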